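/- arXiv:2006.07036 — 2 statements merged into one kernel-verified Lean document; each statement's English description precedes it below -/
import Mathlib

section
/- (Proposition 1) Let x_1,…,x_N ∈ ℝ^D, let k_SM be the SM kernel with Q components, weights w_q ≥ 0, means μ_q, and scales σ_q (with positive coordinates), and let K_SM(X,X) be the N×N matrix with entries k_SM(x_i − x_j). Let m_1,…,m_Q be positive integers, let the spectral points s_{q,i} (q = 1,…,Q, i = 1,…,m_q) be independent with s_{q,i} having independent coordinates distributed as N(μ_{q,d}, σ_{q,d}²), and let Φ be the N×2M random feature matrix (M = Σ_q m_q) whose n-th row is φ_SM(x_n; s). Set W_0 = (Σ_{q=1}^{Q} w_q²)^{1/2} and m_0 = min{m_1,…,m_Q}. Then for every ε > 0, Pr( ‖ΦΦᵀ − K_SM(X,X)‖_2 ≥ ε ) ≤ N · exp( −3ε² m_0 / ( W_0 · N · (6‖K_SM(X,X)‖_2 + 4ε) ) ), where ‖·‖_2 denotes the matrix spectral norm (largest singular value). -/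
open MeasureTheory ProbabilityTheory Real

/-- The spectral mixture (SM) kernel with `Q` components, weights `w`, means `μ`, scales `σ`. -/
noncomputable def kSM {Q D : ℕ} (w : Fin Q → ℝ) (μ σ : Fin Q → Fin D → ℝ)
    (τ : Fin D → ℝ) : ℝ :=
  ∑ q, w q * Real.exp (-2 * π ^ 2 * ∑ d, σ q d ^ 2 * τ d ^ 2) *
    Real.cos (2 * π * ∑ d, μ q d * τ d)

/-- The random Fourier feature map for the SM kernel. -/
noncomputable def phiSM {Q D : ℕ} (w : Fin Q → ℝ) (m : Fin Q → ℕ)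
    (s : (q : Fin Q) → Fin (m q) → Fin D → ℝ) (x : Fin D → ℝ) :
    ((q : Fin Q) × Fin (m q)) × Bool → ℝ :=
  fun j =>
    Real.sqrt (w j.1.1) * (Real.sqrt (m j.1.1))⁻¹ *
      (if j.2 then Real.cos (2 * π * ∑ d, s j.1.1 j.1.2 d * x d)
       else Real.sin (2 * π * ∑ d, s j.1.1 j.1.2 d * x d))

/-- The spectral norm (largest singular value) of a real square matrix, i.e. the operator norm
of the induced endomorphism of Euclidean space. -/
noncomputable def specNorm {N : ℕ} (A : Matrix (Fin N) (Fin N) ℝ) : ℝ :=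
  ‖Matrix.toEuclideanCLM (𝕜 := ℝ) A‖



section SMHelpers

open Matrix

lemma sm_spec {N : ℕ} {A : Matrix (Fin N) (Fin N) ℝ} (hA : A.IsHermitian) :
    ∃ (U : Matrix (Fin N) (Fin N) ℝ) (l : Fin N → ℝ), U * Uᵀ = 1 ∧ Uᵀ * U = 1 ∧
      A = U * diagonal l * Uᵀ ∧
      NormedSpace.exp A = U * diagonal (fun i => Real.exp (l i)) * Uᵀ := by
  set U : Matrix (Fin N) (Fin N) ℝ := (hA.eigenvectorUnitary : Matrix (Fin N) (Fin N) ℝ) with hU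
  have hstar : star U = Uᵀ := by
    rw [star_eq_conjTranspose, conjTranspose_eq_transpose_of_trivial]
  have h1 : U * Uᵀ = 1 := by
    rw [← hstar]; exact Unitary.coe_mul_star_self hA.eigenvectorUnitary
  have h2 : Uᵀ * U = 1 := by
    rw [← hstar]; exact Unitary.coe_star_mul_self hA.eigenvectorUnitary
  have h3 : A = U * diagonal hA.eigenvalues * Uᵀ := by
    have := hA.spectral_theorem
    rw [Unitary.conjStarAlgAut_apply] at this
    rw [← hstar]
    exact this
  refine ⟨U, hA.eigenvalues, h1, h2, h3, ?_⟩
  have hinv : U⁻¹ = Uᵀ := Matrix.inv_eq_right_inv h1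
  have hu : IsUnit U := IsUnit.of_mul_eq_one _ h1
  conv_lhs => rw [h3, ← hinv]
  rw [Matrix.exp_conj _ _ hu, Matrix.exp_diagonal, hinv, Pi.exp_def]
  simp only [← Real.exp_eq_exp_ℝ]

lemma sm_int_sq {a : ℝ} (ha : 0 < a) :
    IntegrableOn (fun s : ℝ => 1 / (a + s) ^ 2) (Set.Ioi 0) ∧
      ∫ s in Set.Ioi (0 : ℝ), 1 / (a + s) ^ 2 = 1 / a := by
  have hd : ∀ s ∈ Set.Ici (0 : ℝ), HasDerivAt (fun s : ℝ => -(a + s)⁻¹) (1 / (a + s) ^ 2) s := by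
    intro s hs
    have hs' : (a + s) ≠ 0 := by have : (0 : ℝ) ≤ s := hs; positivity
    have := (((hasDerivAt_id s).const_add a).inv hs').neg
    refine this.congr_deriv ?_
    simp [neg_div]
  have ht : Filter.Tendsto (fun s : ℝ => -(a + s)⁻¹) Filter.atTop (nhds 0) := by
    have := (tendsto_inv_atTop_zero.comp (Filter.tendsto_atTop_add_const_left Filter.atTop a
      Filter.tendsto_id)).neg
    simpa using this
  have hi := integrableOn_Ioi_deriv_of_nonneg' hd (fun s hs => by positivity) ht
  refine ⟨hi, ?_⟩
  rw [integral_Ioi_of_hasDerivAt_of_tendsto' hd hi ht]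
  simp

lemma sm_int_two {a b : ℝ} (ha : 0 < a) (hb : 0 < b) :
    IntegrableOn (fun s : ℝ => 1 / ((a + s) * (b + s))) (Set.Ioi 0) := by
  refine Integrable.mono' ((sm_int_sq ha).1.add (sm_int_sq hb).1) ?_ ?_
  · refine ContinuousOn.aestronglyMeasurable ?_ measurableSet_Ioi
    refine ContinuousOn.div (by fun_prop) (by fun_prop) ?_
    intro s hs
    have : (0 : ℝ) < s := hs
    positivity
  · filter_upwards [ae_restrict_mem measurableSet_Ioi] with s hs
    have : (0 : ℝ) < s := hs
    rw [Real.norm_of_nonneg (by positivity)]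
    have e1 : 1 / ((a + s) * (b + s)) = (1/(a+s)) * (1/(b+s)) := by field_simp
    simp only [Pi.add_apply]
    have e2 : 1 / (a + s)^2 = (1/(a+s))^2 := by field_simp
    have e3 : 1 / (b + s)^2 = (1/(b+s))^2 := by field_simp
    rw [e1, e2, e3]
    nlinarith [sq_nonneg (1/(a+s) - 1/(b+s)), sq_nonneg (1/(a+s)), sq_nonneg (1/(b+s))]

lemma sm_tendsto_log (a : ℝ) :
    Filter.Tendsto (fun s : ℝ => Real.log (a + s) - Real.log (1 + s)) Filter.atTop (nhds 0) := by
  have h : Filter.Tendsto (fun s : ℝ => (a + s) / (1 + s)) Filter.atTop (nhds 1) := by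
    have h1 : Filter.Tendsto (fun s : ℝ => (1 + s)⁻¹) Filter.atTop (nhds 0) :=
      tendsto_inv_atTop_zero.comp (Filter.tendsto_atTop_add_const_left Filter.atTop 1
        Filter.tendsto_id)
    have h2 := (h1.const_mul (a - 1)).const_add 1
    simp only [mul_zero, add_zero] at h2
    refine h2.congr' ?_
    filter_upwards [Filter.eventually_gt_atTop 0] with s hs
    have : (1 + s) ≠ 0 := by positivity
    field_simp
    ring
  have h3 := (Real.continuousAt_log (one_ne_zero)).tendsto.comp h
  rw [Real.log_one] at h3
  refine h3.congr' ?_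
  filter_upwards [Filter.eventually_gt_atTop 0, Filter.eventually_gt_atTop (-a)] with s hs hs2
  have : (1 + s) ≠ 0 := by positivity
  have : (a + s) ≠ 0 := by linarith
  simp only [Function.comp]
  rw [Real.log_div (by assumption) (by assumption)]

lemma sm_int_log {a : ℝ} (ha : 0 < a) :
    IntegrableOn (fun s : ℝ => 1 / (a + s) - 1 / (1 + s)) (Set.Ioi 0) ∧
      ∫ s in Set.Ioi (0 : ℝ), (1 / (a + s) - 1 / (1 + s)) = - Real.log a := by
  have hd : ∀ s ∈ Set.Ici (0 : ℝ), HasDerivAt (fun s : ℝ => Real.log (a + s) - Real.log (1 + s))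
      (1 / (a + s) - 1 / (1 + s)) s := by
    intro s hs
    have h0 : (0 : ℝ) ≤ s := hs
    exact (((hasDerivAt_id s).const_add a).log (by simp only [id]; positivity)).sub
      (((hasDerivAt_id s).const_add 1).log (by simp only [id]; positivity))
  have hi : IntegrableOn (fun s : ℝ => 1 / (a + s) - 1 / (1 + s)) (Set.Ioi 0) := by
    have := (sm_int_two ha one_pos).const_mul (1 - a)
    refine this.congr ?_
    filter_upwards [ae_restrict_mem measurableSet_Ioi] with s hs
    have : (0 : ℝ) < s := hs
    field_simp
    ring
  refine ⟨hi, ?_⟩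
  rw [integral_Ioi_of_hasDerivAt_of_tendsto' hd hi (sm_tendsto_log a)]
  simp

noncomputable def smH (p r : ℝ) : ℝ :=
  if p = r then Real.log p + 1 else (p * Real.log p - r * Real.log r) / (p - r)

lemma sm_int_J {m p r : ℝ} (hm : 0 < m) (hp : 0 < p) (hr : 0 < r) :
    IntegrableOn (fun s : ℝ => 1 / (m / p + s) + 1 / (m / r + s)
      - s * (1 / (m / p + s) * (1 / (m / r + s))) - 1 / (1 + s)) (Set.Ioi 0) ∧
    ∫ s in Set.Ioi (0 : ℝ), (1 / (m / p + s) + 1 / (m / r + s)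
      - s * (1 / (m / p + s) * (1 / (m / r + s))) - 1 / (1 + s)) = - Real.log m + smH p r := by
  have ha : 0 < m / p := by positivity
  have hb : 0 < m / r := by positivity
  by_cases h : p = r
  · subst h
    have hc : ∀ᵐ s ∂(volume.restrict (Set.Ioi (0:ℝ))), (1 / (m / p + s) - 1 / (1 + s))
        + (m / p) * (1 / (m / p + s) ^ 2) = 1 / (m / p + s) + 1 / (m / p + s)
      - s * (1 / (m / p + s) * (1 / (m / p + s))) - 1 / (1 + s) := by
      filter_upwards [ae_restrict_mem measurableSet_Ioi] with s hs
      have : (0 : ℝ) < s := hs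
      have h1 : (m / p + s) ≠ 0 := by positivity
      generalize m / p = a at *
      field_simp
      ring
    have h1 := sm_int_log ha
    have h2 := sm_int_sq ha
    refine ⟨(h1.1.add (h2.1.const_mul (m / p))).congr hc, ?_⟩
    rw [← integral_congr_ae hc, integral_add h1.1 (h2.1.const_mul (m/p)), h1.2,
      integral_const_mul, h2.2, Real.log_div hm.ne' hp.ne']
    simp only [smH, if_true]
    field_simp
    ring
  · have hpr : p - r ≠ 0 := sub_ne_zero.mpr h
    have hc : ∀ᵐ s ∂(volume.restrict (Set.Ioi (0:ℝ))),
        (p / (p - r)) * (1 / (m / p + s) - 1 / (1 + s)) -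
        (r / (p - r)) * (1 / (m / r + s) - 1 / (1 + s)) =
        1 / (m / p + s) + 1 / (m / r + s)
      - s * (1 / (m / p + s) * (1 / (m / r + s))) - 1 / (1 + s) := by
      filter_upwards [ae_restrict_mem measurableSet_Ioi] with s hs
      have : (0 : ℝ) < s := hs
      have e1 : 1 / (m / p + s) = p / (m + s * p) := by field_simp
      have e2 : 1 / (m / r + s) = r / (m + s * r) := by field_simp
      rw [e1, e2]
      have : m + s * p ≠ 0 := by positivity
      have : m + s * r ≠ 0 := by positivity
      have : 1 + s ≠ 0 := by positivity
      field_simp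
      ring
    have h1 := sm_int_log ha
    have h2 := sm_int_log hb
    refine ⟨((h1.1.const_mul (p / (p - r))).sub (h2.1.const_mul (r / (p - r)))).congr hc, ?_⟩
    rw [← integral_congr_ae hc, integral_sub (h1.1.const_mul _) (h2.1.const_mul _),
      integral_const_mul, integral_const_mul, h1.2, h2.2, Real.log_div hm.ne' hp.ne',
      Real.log_div hm.ne' hr.ne']
    simp only [smH, if_neg h]
    field_simp
    ring

lemma sm_tr_YDC {N : ℕ} (Y C : Matrix (Fin N) (Fin N) ℝ) (t : Fin N → ℝ) :
    trace (Yᵀ * diagonal t * C) = ∑ j, ∑ l, Y j l * t j * C j l := by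
  rw [trace, Finset.sum_comm]
  refine Finset.sum_congr rfl fun l _ => ?_
  simp [Matrix.mul_apply, diagonal_apply]

lemma sm_tr_YTC {N : ℕ} (Y T C : Matrix (Fin N) (Fin N) ℝ) :
    trace (Yᵀ * T * C) = ∑ i, ∑ j, ∑ k, Y i k * T i j * C j k := by
  simp only [trace, diag_apply, Matrix.mul_apply, transpose_apply, Finset.sum_mul]
  have : ∀ f : Fin N → Fin N → Fin N → ℝ, ∑ k, ∑ j, ∑ i, f i j k = ∑ i, ∑ j, ∑ k, f i j k := by
    intro f
    rw [Finset.sum_comm]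
    rw [Finset.sum_congr rfl fun j _ => Finset.sum_comm]
    rw [Finset.sum_comm]
  exact this _

lemma sm_quad_ineq {N : ℕ} {U V : Matrix (Fin N) (Fin N) ℝ} (hU : U * Uᵀ = 1) (hU' : Uᵀ * U = 1)
    (hV : V * Vᵀ = 1) {t a : Fin N → ℝ} (ht : ∀ i, 0 < t i) (ha : ∀ i, 0 < a i)
    (Z : Matrix (Fin N) (Fin N) ℝ) {s : ℝ} (hs : 0 < s) :
    2 * trace (Zᵀ * (U * diagonal t * Uᵀ)) - trace ((V * diagonal a * Vᵀ) * (Zᵀ * Z))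
      - s * trace (Zᵀ * (U * diagonal t * Uᵀ) * Z) ≤
    ∑ j, ∑ l, (Uᵀ * V) j l ^ 2 * t j * (1 / (a l / t j + s)) := by
  set Y := Uᵀ * Z * V with hY
  set C := Uᵀ * V with hC
  have e1 : trace (Zᵀ * (U * diagonal t * Uᵀ)) = ∑ j, ∑ l, Y j l * t j * C j l := by
    rw [← sm_tr_YDC, hY, hC]
    simp only [transpose_mul, transpose_transpose, Matrix.mul_assoc]
    rw [trace_mul_comm Vᵀ]
    simp only [Matrix.mul_assoc, hV, Matrix.mul_one]
  have e2 : trace ((V * diagonal a * Vᵀ) * (Zᵀ * Z)) = ∑ j, ∑ l, Y j l * a l * Y j l := by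
    have := sm_tr_YDC Yᵀ Yᵀ a
    rw [Finset.sum_comm] at this
    simp only [transpose_apply] at this
    rw [← this, hY]
    simp only [transpose_mul, transpose_transpose, Matrix.mul_assoc]
    rw [trace_mul_comm Uᵀ]
    simp only [Matrix.mul_assoc, hU, Matrix.mul_one]
    rw [trace_mul_comm Z]
    simp only [Matrix.mul_assoc]
  have e3 : trace (Zᵀ * (U * diagonal t * Uᵀ) * Z) = ∑ j, ∑ l, Y j l * t j * Y j l := by
    rw [← sm_tr_YDC, hY]
    simp only [transpose_mul, transpose_transpose, Matrix.mul_assoc]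
    rw [trace_mul_comm Vᵀ]
    simp only [Matrix.mul_assoc, hV, Matrix.mul_one]
  rw [e1, e2, e3]
  simp only [Finset.mul_sum, ← Finset.sum_sub_distrib]
  refine Finset.sum_le_sum fun j _ => Finset.sum_le_sum fun l _ => ?_
  have h1 := ht j
  have h2 := ha l
  have e : C j l ^ 2 * t j * (1 / (a l / t j + s)) = (C j l * t j) ^ 2 / (a l + s * t j) := by
    field_simp
  rw [e, le_div_iff₀ (by positivity)]
  nlinarith [sq_nonneg (Y j l * (a l + s * t j) - C j l * t j)]

lemma sm_lieb {N : ℕ} {H W : Matrix (Fin N) (Fin N) ℝ} (hH : H.IsHermitian) (hW : W.IsHermitian) :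
    ∃ G : Matrix (Fin N) (Fin N) ℝ,
      (∀ B : Matrix (Fin N) (Fin N) ℝ, (∀ v, 0 ≤ v ⬝ᵥ (B *ᵥ v)) → 0 ≤ trace (B * G)) ∧
      trace (NormedSpace.exp W * G) = trace (NormedSpace.exp (H + W)) ∧
      ∀ X : Matrix (Fin N) (Fin N) ℝ, X.IsHermitian →
        trace (NormedSpace.exp (H + X)) ≤ trace (NormedSpace.exp X * G) := by
  obtain ⟨U, p, hU, hU', hHW, eHW⟩ := sm_spec (hH.add hW)
  obtain ⟨V, m, hV, hV', hWe, eW⟩ := sm_spec hW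
  set C := Uᵀ * V with hC
  have hCC : C * Cᵀ = 1 := by
    rw [hC, transpose_mul, transpose_transpose, Matrix.mul_assoc, ← Matrix.mul_assoc V, hV,
      Matrix.one_mul, hU']
  have hCC' : ∀ i j, ∑ k, C i k * C j k = if i = j then 1 else 0 := by
    intro i j
    have := congrFun (congrFun hCC i) j
    simpa [Matrix.mul_apply, Matrix.one_apply] using this
  let F : Fin N → Fin N → ℝ → ℝ := fun i k s => 1 / (Real.exp (m k) / Real.exp (p i) + s)
  have hapos : ∀ i k, 0 < Real.exp (m k) / Real.exp (p i) := fun i k => by positivity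
  let Y : ℝ → Matrix (Fin N) (Fin N) ℝ := fun s => Matrix.of fun i k => C i k * F i k s
  let Z : ℝ → Matrix (Fin N) (Fin N) ℝ := fun s => U * Y s * Vᵀ
  have hYint : ∀ k l, IntegrableOn (fun s => ((Y s)ᵀ * Y s) k l) (Set.Ioi 0) := by
    intro k l
    simp only [Matrix.mul_apply, transpose_apply]
    refine integrable_finsetSum _ fun i _ => ?_
    have := (sm_int_two (hapos i k) (hapos i l)).const_mul (C i k * C i l)
    refine this.congr (Filter.Eventually.of_forall fun s => ?_)
    simp only [Y, F, of_apply]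
    rw [← one_div_mul_one_div]
    ring
  let Gh : Matrix (Fin N) (Fin N) ℝ := Matrix.of fun k l => ∫ s in Set.Ioi (0:ℝ), ((Y s)ᵀ * Y s) k l
  let G := V * Gh * Vᵀ
  have htr : ∀ B : Matrix (Fin N) (Fin N) ℝ,
      IntegrableOn (fun s => trace (B * ((Z s)ᵀ * Z s))) (Set.Ioi 0) ∧
      ∫ s in Set.Ioi (0:ℝ), trace (B * ((Z s)ᵀ * Z s)) = trace (B * G) := by
    intro B
    have e1 : ∀ s, trace (B * ((Z s)ᵀ * Z s)) =
        ∑ k, ∑ l, (Vᵀ * B * V) k l * ((Y s)ᵀ * Y s) l k := by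
      intro s
      have : trace (B * ((Z s)ᵀ * Z s)) = trace ((Vᵀ * B * V) * ((Y s)ᵀ * Y s)) := by
        simp only [Z, transpose_mul, transpose_transpose, Matrix.mul_assoc]
        rw [← Matrix.mul_assoc Uᵀ, hU', Matrix.one_mul, trace_mul_comm Vᵀ]
        simp only [Matrix.mul_assoc]
      rw [this]
      simp only [trace, diag_apply, Matrix.mul_apply (M := Vᵀ * B * V)]
    have e2 : trace (B * G) = ∑ k, ∑ l, (Vᵀ * B * V) k l * Gh l k := by
      have : trace (B * G) = trace ((Vᵀ * B * V) * Gh) := by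
        simp only [G, Matrix.mul_assoc]
        rw [trace_mul_comm Vᵀ]
        simp only [Matrix.mul_assoc]
      rw [this]
      simp only [trace, diag_apply, Matrix.mul_apply (M := Vᵀ * B * V)]
    simp only [e1]
    have hi : ∀ k l, IntegrableOn (fun s => (Vᵀ * B * V) k l * ((Y s)ᵀ * Y s) l k) (Set.Ioi 0) :=
      fun k l => (hYint l k).const_mul _
    refine ⟨integrable_finsetSum _ fun k _ => integrable_finsetSum _ fun l _ => hi k l, ?_⟩
    rw [integral_finsetSum _ fun k _ => integrable_finsetSum _ fun l _ => hi k l, e2]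
    refine Finset.sum_congr rfl fun k _ => ?_
    rw [integral_finsetSum _ fun l _ => hi k l]
    refine Finset.sum_congr rfl fun l _ => ?_
    rw [integral_const_mul]
    rfl
  refine ⟨G, ?_, ?_, ?_⟩
  · intro B hB
    rw [← (htr B).2]
    refine integral_nonneg fun s => ?_
    have : trace (B * ((Z s)ᵀ * Z s)) = ∑ j, (Z s) j ⬝ᵥ (B *ᵥ (Z s) j) := by
      rw [← Matrix.mul_assoc, trace_mul_comm]
      simp [trace, Matrix.mul_apply, dotProduct, mulVec]
    simp only [this, Pi.zero_apply]
    exact Finset.sum_nonneg fun j _ => hB _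
  · rw [← (htr _).2]
    have e1 : ∀ s, trace (NormedSpace.exp W * ((Z s)ᵀ * Z s)) =
        ∑ i, ∑ k, C i k ^ 2 * Real.exp (m k) * (1 / (Real.exp (m k) / Real.exp (p i) + s) ^ 2) := by
      intro s
      have h1 := sm_tr_YDC (Y s)ᵀ (Y s)ᵀ (fun i => Real.exp (m i))
      rw [Finset.sum_comm] at h1
      have h2 : trace (NormedSpace.exp W * ((Z s)ᵀ * Z s)) =
          trace ((Y s)ᵀᵀ * diagonal (fun i => Real.exp (m i)) * (Y s)ᵀ) := by
        rw [eW]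
        simp only [Z, transpose_mul, transpose_transpose, Matrix.mul_assoc]
        rw [← Matrix.mul_assoc Uᵀ, hU', Matrix.one_mul, trace_mul_comm V]
        simp only [Matrix.mul_assoc, hV', Matrix.mul_one]
        rw [← Matrix.mul_assoc Vᵀ V, hV', Matrix.one_mul, ← Matrix.mul_assoc, trace_mul_comm]
      rw [h2, h1]
      refine Finset.sum_congr rfl fun i _ => Finset.sum_congr rfl fun k _ => ?_
      simp only [Y, F, transpose_apply, of_apply]
      rw [← _root_.one_div_pow]
      ring
    simp only [e1]
    have hi : ∀ i k, IntegrableOn (fun s => C i k ^ 2 * Real.exp (m k) *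
        (1 / (Real.exp (m k) / Real.exp (p i) + s) ^ 2)) (Set.Ioi 0) :=
      fun i k => (sm_int_sq (hapos i k)).1.const_mul _
    rw [integral_finsetSum _ fun k _ => integrable_finsetSum _ fun l _ => hi k l]
    have e3 : trace (NormedSpace.exp (H + W)) = ∑ i, Real.exp (p i) := by
      rw [eHW, trace_mul_comm, ← Matrix.mul_assoc, hU', Matrix.one_mul, trace_diagonal]
    rw [e3]
    refine Finset.sum_congr rfl fun i _ => ?_
    rw [integral_finsetSum _ fun l _ => hi i l]
    have : ∀ k, ∫ s in Set.Ioi (0:ℝ), C i k ^ 2 * Real.exp (m k) *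
        (1 / (Real.exp (m k) / Real.exp (p i) + s) ^ 2) = (C i k * C i k) * Real.exp (p i) := by
      intro k
      rw [integral_const_mul, (sm_int_sq (hapos i k)).2]
      field_simp
    simp only [this]
    rw [← Finset.sum_mul, hCC' i i]
    simp
  · intro X hX
    obtain ⟨U1, t, hU1, hU1', hT, eT⟩ := sm_spec (hH.add hX)
    obtain ⟨U2, a, hU2, hU2', hA, eA⟩ := sm_spec hX
    set T := NormedSpace.exp (H + X) with hTdef
    set A := NormedSpace.exp X with hAdef
    set D := U1ᵀ * U2 with hD
    have hTs : T.IsHermitian := (hH.add hX).exp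
    have hDD : D * Dᵀ = 1 := by
      rw [hD, transpose_mul, transpose_transpose, Matrix.mul_assoc, ← Matrix.mul_assoc U2, hU2,
        Matrix.one_mul, hU1']
    have hDD' : ∀ i, ∑ k, D i k ^ 2 = 1 := by
      intro i
      have := congrFun (congrFun hDD i) i
      simpa [Matrix.mul_apply, Matrix.one_apply, sq] using this
    -- right side
    let g : ℝ → ℝ := fun s => ∑ j, ∑ l, D j l ^ 2 * Real.exp (t j) *
      (1 / (Real.exp (a l) / Real.exp (t j) + s) - 1 / (1 + s))
    have hap : ∀ j l, 0 < Real.exp (a l) / Real.exp (t j) := fun j l => by positivity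
    have hgi : ∀ j l, IntegrableOn (fun s => D j l ^ 2 * Real.exp (t j) *
      (1 / (Real.exp (a l) / Real.exp (t j) + s) - 1 / (1 + s))) (Set.Ioi 0) :=
      fun j l => (sm_int_log (hap j l)).1.const_mul _
    have hgI : IntegrableOn g (Set.Ioi 0) :=
      integrable_finsetSum _ fun k _ => integrable_finsetSum _ fun l _ => hgi k l
    have hgv : ∫ s in Set.Ioi (0:ℝ), g s = trace (T * H) := by
      have e0 : trace (T * H) = trace (T * (H + X)) - trace (T * X) := by
        rw [Matrix.mul_add, trace_add]; ring
      have e1 : trace (T * (H + X)) = ∑ j, Real.exp (t j) * t j := by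
        rw [eT, hT]
        have : U1 * diagonal (fun i => Real.exp (t i)) * U1ᵀ * (U1 * diagonal t * U1ᵀ) =
          U1 * (diagonal (fun i => Real.exp (t i)) * diagonal t) * U1ᵀ := by
          simp only [Matrix.mul_assoc]
          rw [← Matrix.mul_assoc U1ᵀ U1, hU1', Matrix.one_mul]
        rw [this, trace_mul_comm, ← Matrix.mul_assoc, hU1', Matrix.one_mul, diagonal_mul_diagonal,
          trace_diagonal]
      have e2 : trace (T * X) = ∑ j, ∑ l, D j l * Real.exp (t j) * (D j l * a l) := by
        have h1 := sm_tr_YDC D (D * diagonal a) (fun i => Real.exp (t i))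
        simp only [mul_diagonal] at h1
        rw [← h1, eT, hA, hD]
        simp only [transpose_mul, transpose_transpose, Matrix.mul_assoc]
        rw [trace_mul_comm U2ᵀ, trace_mul_comm U1]
        simp only [Matrix.mul_assoc]
        rw [trace_mul_comm U1]
        simp only [Matrix.mul_assoc]
      rw [integral_finsetSum _ fun k _ => integrable_finsetSum _ fun l _ => hgi k l, e0, e1, e2,
        ← Finset.sum_sub_distrib]
      refine Finset.sum_congr rfl fun j _ => ?_
      rw [integral_finsetSum _ fun l _ => hgi j l]
      have : Real.exp (t j) * t j = ∑ l, D j l ^ 2 * (Real.exp (t j) * t j) := by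
        rw [← Finset.sum_mul, hDD', one_mul]
      rw [this, ← Finset.sum_sub_distrib]
      refine Finset.sum_congr rfl fun l _ => ?_
      rw [integral_const_mul, (sm_int_log (hap j l)).2, Real.log_div (by positivity) (by positivity),
        Real.log_exp, Real.log_exp]
      ring
    -- left side
    set Th := Uᵀ * T * U with hTh
    have hThs : ∀ i j, Th j i = Th i j := by
      intro i j
      have : Thᵀ = Th := by
        have h := hTs
        rw [Matrix.IsHermitian, conjTranspose_eq_transpose_of_trivial] at h
        rw [hTh]
        simp only [transpose_mul, transpose_transpose, Matrix.mul_assoc, h]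
      exact congrFun (congrFun this i) j
    let J : Fin N → Fin N → Fin N → ℝ → ℝ := fun i j k s =>
      1 / (Real.exp (m k) / Real.exp (p i) + s) + 1 / (Real.exp (m k) / Real.exp (p j) + s)
      - s * (1 / (Real.exp (m k) / Real.exp (p i) + s) * (1 / (Real.exp (m k) / Real.exp (p j) + s)))
      - 1 / (1 + s)
    let f : ℝ → ℝ := fun s => ∑ i, ∑ j, ∑ k, Th i j * C i k * C j k * J i j k s
    have hfi : ∀ i j k, IntegrableOn (fun s => Th i j * C i k * C j k * J i j k s) (Set.Ioi 0) :=
      fun i j k => (sm_int_J (Real.exp_pos _) (Real.exp_pos _) (Real.exp_pos _)).1.const_mul _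
    have hfI : IntegrableOn f (Set.Ioi 0) :=
      integrable_finsetSum _ fun k _ => integrable_finsetSum _ fun l _ =>
        integrable_finsetSum _ fun j _ => hfi k l j
    have htrT : trace T = ∑ i, Th i i := by
      have : trace T = trace Th := by
        rw [hTh, trace_mul_comm, ← Matrix.mul_assoc, hU, Matrix.one_mul]
      rw [this]; rfl
    have hfe : ∀ s, f s = 2 * trace ((Z s)ᵀ * T) - s * trace ((Z s)ᵀ * T * Z s)
        - trace T * (1 / (1 + s)) := by
      intro s
      have hZT : (Z s)ᵀ * T = V * (Y s)ᵀ * Uᵀ * T := by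
        simp only [Z, transpose_mul, transpose_transpose, Matrix.mul_assoc]
      have e1 : trace ((Z s)ᵀ * T) = ∑ i, ∑ j, ∑ k, Y s i k * Th i j * C j k := by
        rw [← sm_tr_YTC, hZT, hTh, hC]
        simp only [Matrix.mul_assoc]
        rw [← Matrix.mul_assoc U Uᵀ, hU, Matrix.one_mul, trace_mul_comm V]
        simp only [Matrix.mul_assoc]
      have e1' : trace ((Z s)ᵀ * T) = ∑ i, ∑ j, ∑ k, Y s j k * Th i j * C i k := by
        rw [e1, Finset.sum_comm]
        refine Finset.sum_congr rfl fun i _ => Finset.sum_congr rfl fun j _ =>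
          Finset.sum_congr rfl fun k _ => ?_
        rw [hThs]
      have e2 : trace ((Z s)ᵀ * T * Z s) = ∑ i, ∑ j, ∑ k, Y s i k * Th i j * Y s j k := by
        rw [← sm_tr_YTC, hZT, hTh]
        simp only [Z, Matrix.mul_assoc]
        rw [trace_mul_comm V]
        simp only [Matrix.mul_assoc, hV', Matrix.mul_one]
      have e3 : trace T = ∑ i, ∑ j, ∑ k, Th i j * (C i k * C j k) := by
        simp only [← Finset.mul_sum, hCC']
        simp [htrT]
      rw [two_mul]
      nth_rewrite 1 [e1]
      rw [e1', e2, e3]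
      simp only [Finset.mul_sum, Finset.sum_mul, ← Finset.sum_sub_distrib, ← Finset.sum_add_distrib]
      refine Finset.sum_congr rfl fun i _ => Finset.sum_congr rfl fun j _ =>
          Finset.sum_congr rfl fun k _ => ?_
      simp only [Y, F, J, of_apply]
      ring
    have hfv : ∫ s in Set.Ioi (0:ℝ), f s = trace (T * H) + trace T := by
      have e0 : trace (T * H) = trace (T * (H + W)) - trace (T * W) := by
        rw [Matrix.mul_add, trace_add]; ring
      have e1 : trace (T * (H + W)) = ∑ i, Th i i * p i := by
        have : trace (T * (H + W)) = trace (Th * diagonal p) := by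
          rw [hHW, hTh]
          simp only [Matrix.mul_assoc]
          rw [trace_mul_comm Uᵀ]
          simp only [Matrix.mul_assoc]
        rw [this]
        simp [trace, mul_diagonal]
      have e2 : trace (T * W) = ∑ i, ∑ j, ∑ k, C i k * Th i j * (C j k * m k) := by
        have h1 := sm_tr_YTC C Th (C * diagonal m)
        simp only [mul_diagonal] at h1
        rw [← h1, hWe, hTh, hC]
        simp only [transpose_mul, transpose_transpose, Matrix.mul_assoc]
        rw [← Matrix.mul_assoc U Uᵀ, hU, Matrix.one_mul, ← Matrix.mul_assoc U Uᵀ, hU,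
          Matrix.one_mul, trace_mul_comm Vᵀ]
        simp only [Matrix.mul_assoc]
      have e3 : ∫ s in Set.Ioi (0:ℝ), f s =
          ∑ i, ∑ j, ∑ k, Th i j * C i k * C j k * (- m k + smH (Real.exp (p i)) (Real.exp (p j))) := by
        rw [integral_finsetSum _ fun k _ => integrable_finsetSum _ fun l _ =>
          integrable_finsetSum _ fun j _ => hfi k l j]
        refine Finset.sum_congr rfl fun i _ => ?_
        rw [integral_finsetSum _ fun l _ => integrable_finsetSum _ fun j _ => hfi i l j]
        refine Finset.sum_congr rfl fun j _ => ?_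
        rw [integral_finsetSum _ fun k _ => hfi i j k]
        refine Finset.sum_congr rfl fun k _ => ?_
        rw [integral_const_mul,
          (sm_int_J (Real.exp_pos _) (Real.exp_pos _) (Real.exp_pos _)).2, Real.log_exp]
      have e4 : ∑ i, Th i i * p i + ∑ i, Th i i =
          ∑ i, ∑ j, ∑ k, (Th i j * smH (Real.exp (p i)) (Real.exp (p j))) * (C i k * C j k) := by
        simp only [← Finset.mul_sum, hCC']
        rw [← Finset.sum_add_distrib]
        refine Finset.sum_congr rfl fun i _ => ?_
        simp [smH]
        ring
      rw [e0, e1, e2, e3, htrT, sub_add_eq_add_sub, e4]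
      simp only [← Finset.sum_sub_distrib]
      refine Finset.sum_congr rfl fun i _ => Finset.sum_congr rfl fun j _ =>
          Finset.sum_congr rfl fun k _ => ?_
      ring
    have hmono : ∫ s in Set.Ioi (0:ℝ), (f s - trace (A * ((Z s)ᵀ * Z s))) ≤
        ∫ s in Set.Ioi (0:ℝ), g s := by
      refine setIntegral_mono_on (hfI.sub (htr A).1) hgI measurableSet_Ioi ?_
      intro s hs
      have h := sm_quad_ineq hU1 hU1' hU2 (fun i => Real.exp_pos (t i)) (fun i => Real.exp_pos (a i))
        (Z s) hs
      rw [← eT, ← eA] at h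
      have hg : g s = ∑ j, ∑ l, D j l ^ 2 * Real.exp (t j) *
          (1 / (Real.exp (a l) / Real.exp (t j) + s)) - trace T * (1 / (1 + s)) := by
        have : trace T = ∑ j, ∑ l, D j l ^ 2 * Real.exp (t j) := by
          simp only [← Finset.sum_mul, hDD', one_mul]
          rw [eT, trace_mul_comm, ← Matrix.mul_assoc, hU1', Matrix.one_mul, trace_diagonal]
        rw [this]
        simp only [Finset.sum_mul, ← Finset.sum_sub_distrib, g]
        refine Finset.sum_congr rfl fun i _ => Finset.sum_congr rfl fun j _ => ?_
        ring
      rw [hg, hfe]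
      linarith
    rw [integral_sub hfI (htr A).1, hgv, hfv, (htr A).2] at hmono
    linarith

def SMGood {N : ℕ} {Ω : Type*} [MeasurableSpace Ω] (f : Ω → Matrix (Fin N) (Fin N) ℝ) : Prop :=
  (∀ ω, (f ω).IsHermitian) ∧ (∀ i j, Measurable fun ω => f ω i j) ∧
    ∃ C : ℝ, ∀ ω i j, |f ω i j| ≤ C

def SMDom {N : ℕ} {Ω : Type*} [MeasurableSpace Ω] (P : Measure Ω)
    (f : Ω → Matrix (Fin N) (Fin N) ℝ) (W : Matrix (Fin N) (Fin N) ℝ) : Prop :=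
  SMGood f ∧ W.IsHermitian ∧ ∀ H : Matrix (Fin N) (Fin N) ℝ, H.IsHermitian →
    ∫ ω, trace (NormedSpace.exp (H + f ω)) ∂P ≤ trace (NormedSpace.exp (H + W))

lemma sm_exp_cont (N : ℕ) :
    Continuous (fun A : Matrix (Fin N) (Fin N) ℝ => NormedSpace.exp A) := by
  let : NormedRing (Matrix (Fin N) (Fin N) ℝ) := Matrix.linftyOpNormedRing
  let : NormedAlgebra ℝ (Matrix (Fin N) (Fin N) ℝ) := Matrix.linftyOpNormedAlgebra
  let : NormedAlgebra ℚ (Matrix (Fin N) (Fin N) ℝ) := NormedAlgebra.restrictScalars ℚ ℝ _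
  exact NormedSpace.exp_continuous

lemma SMGood.measurable {N : ℕ} {Ω : Type*} [MeasurableSpace Ω]
    {f : Ω → Matrix (Fin N) (Fin N) ℝ} (hf : SMGood f) {F : Matrix (Fin N) (Fin N) ℝ → ℝ}
    (hF : Continuous F) : Measurable fun ω => F (f ω) := by
  have h1 : Measurable (fun ω => (fun i j => f ω i j : Fin N → Fin N → ℝ)) :=
    measurable_pi_iff.mpr fun i => measurable_pi_iff.mpr fun j => hf.2.1 i j
  have h2 : Continuous (fun g : Fin N → Fin N → ℝ => F (Matrix.of g)) :=
    hF.comp (continuous_id)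
  exact h2.measurable.comp h1

lemma SMGood.bounded {N : ℕ} {Ω : Type*} [MeasurableSpace Ω]
    {f : Ω → Matrix (Fin N) (Fin N) ℝ} (hf : SMGood f) {F : Matrix (Fin N) (Fin N) ℝ → ℝ}
    (hF : Continuous F) : ∃ C, ∀ ω, |F (f ω)| ≤ C := by
  obtain ⟨C, hC⟩ := hf.2.2
  have h2 : Continuous (fun g : Fin N → Fin N → ℝ => F (Matrix.of g)) :=
    hF.comp (continuous_id)
  have hK : IsCompact (Set.univ.pi fun _ : Fin N => Set.univ.pi fun _ : Fin N => Set.Icc (-C) C) :=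
    isCompact_univ_pi fun _ => isCompact_univ_pi fun _ => isCompact_Icc
  obtain ⟨M, hM⟩ := hK.exists_bound_of_continuousOn h2.continuousOn
  refine ⟨M, fun ω => ?_⟩
  have := hM (fun i j => f ω i j) (by
    intro i _ j _
    exact abs_le.mp (hC ω i j))
  exact this

lemma SMGood.integrable {N : ℕ} {Ω : Type*} [MeasurableSpace Ω] {P : Measure Ω}
    [IsProbabilityMeasure P]
    {f : Ω → Matrix (Fin N) (Fin N) ℝ} (hf : SMGood f) {F : Matrix (Fin N) (Fin N) ℝ → ℝ}
    (hF : Continuous F) : Integrable (fun ω => F (f ω)) P := by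
  obtain ⟨C, hC⟩ := hf.bounded hF
  exact Integrable.of_bound (hf.measurable hF).aestronglyMeasurable C
    (Filter.Eventually.of_forall hC)

lemma sm_cont_tr {N : ℕ} (H : Matrix (Fin N) (Fin N) ℝ) :
    Continuous (fun A : Matrix (Fin N) (Fin N) ℝ => trace (NormedSpace.exp (H + A))) :=
  ((sm_exp_cont N).comp (continuous_const.add continuous_id)).matrix_trace

lemma sm_dom_of_exp {N : ℕ} {Ω : Type*} [MeasurableSpace Ω] {P : Measure Ω}
    [IsProbabilityMeasure P] {f : Ω → Matrix (Fin N) (Fin N) ℝ} (hf : SMGood f)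
    {W : Matrix (Fin N) (Fin N) ℝ} (hW : W.IsHermitian)
    (hexp : ∀ v, ∫ ω, v ⬝ᵥ (NormedSpace.exp (f ω) *ᵥ v) ∂P ≤ v ⬝ᵥ (NormedSpace.exp W *ᵥ v)) :
    SMDom P f W := by
  refine ⟨hf, hW, fun H hH => ?_⟩
  obtain ⟨G, hG, hG1, hG2⟩ := sm_lieb hH hW
  let E : Matrix (Fin N) (Fin N) ℝ := Matrix.of fun i j => ∫ ω, NormedSpace.exp (f ω) i j ∂P
  have hent : ∀ i j, Integrable (fun ω => NormedSpace.exp (f ω) i j) P := fun i j =>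
    hf.integrable (F := fun A => NormedSpace.exp A i j) ((sm_exp_cont N).matrix_elem i j)
  have e1 : ∀ v, v ⬝ᵥ (E *ᵥ v) = ∫ ω, v ⬝ᵥ (NormedSpace.exp (f ω) *ᵥ v) ∂P := by
    intro v
    simp only [dotProduct, mulVec]
    have h1 : ∀ i j, Integrable (fun ω => NormedSpace.exp (f ω) i j * v j) P :=
      fun i j => (hent i j).mul_const _
    have h2 : ∀ i, Integrable (fun ω => ∑ j, NormedSpace.exp (f ω) i j * v j) P :=
      fun i => integrable_finsetSum _ fun j _ => h1 i j
    rw [integral_finsetSum _ fun i _ => (h2 i).const_mul (v i)]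
    refine Finset.sum_congr rfl fun i _ => ?_
    rw [integral_const_mul, integral_finsetSum _ fun j _ => h1 i j]
    congr 1
    refine Finset.sum_congr rfl fun j _ => ?_
    rw [integral_mul_const]
    rfl
  have e2 : trace (E * G) = ∫ ω, trace (NormedSpace.exp (f ω) * G) ∂P := by
    simp only [trace, diag_apply, Matrix.mul_apply]
    have h1 : ∀ i j, Integrable (fun ω => NormedSpace.exp (f ω) i j * G j i) P :=
      fun i j => (hent i j).mul_const _
    rw [integral_finsetSum _ fun i _ => integrable_finsetSum _ fun j _ => h1 i j]
    refine Finset.sum_congr rfl fun i _ => ?_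
    rw [integral_finsetSum _ fun j _ => h1 i j]
    refine Finset.sum_congr rfl fun j _ => ?_
    rw [integral_mul_const]
    rfl
  have h3 : 0 ≤ trace ((NormedSpace.exp W - E) * G) := by
    refine hG _ fun v => ?_
    rw [sub_mulVec, dotProduct_sub, e1]
    linarith [hexp v]
  rw [Matrix.sub_mul, trace_sub, hG1, e2] at h3
  have h4 : ∫ ω, trace (NormedSpace.exp (H + f ω)) ∂P ≤
      ∫ ω, trace (NormedSpace.exp (f ω) * G) ∂P := by
    refine integral_mono (hf.integrable (sm_cont_tr H)) (hf.integrable (F := fun A =>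
      trace (NormedSpace.exp A * G)) ?_) fun ω => hG2 _ (hf.1 ω)
    exact ((sm_exp_cont N).matrix_mul continuous_const).matrix_trace
  linarith

lemma sm_dom_pi {N : ℕ} : ∀ (n : ℕ) {Ω : Fin n → Type} [∀ i, MeasurableSpace (Ω i)]
    (P : ∀ i, Measure (Ω i)) [∀ i, IsProbabilityMeasure (P i)]
    (f : ∀ i, Ω i → Matrix (Fin N) (Fin N) ℝ) (W : Fin n → Matrix (Fin N) (Fin N) ℝ),
    (∀ i, SMDom (P i) (f i) (W i)) →
    SMDom (Measure.pi P) (fun ω => ∑ i, f i (ω i)) (∑ i, W i) := by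
  have hgood : ∀ (n : ℕ) {Ω : Fin n → Type} [∀ i, MeasurableSpace (Ω i)]
    (f : ∀ i, Ω i → Matrix (Fin N) (Fin N) ℝ), (∀ i, SMGood (f i)) →
    SMGood (fun ω : (∀ i, Ω i) => ∑ i, f i (ω i)) := by
    intro n Ω _ f hf
    refine ⟨fun ω => ?_, fun i j => ?_, ?_⟩
    · rw [Matrix.IsHermitian, conjTranspose_sum]
      exact Finset.sum_congr rfl fun i _ => (hf i).1 _
    · simp only [Matrix.sum_apply]
      exact Finset.measurable_sum _ fun k _ => ((hf k).2.1 i j).comp (measurable_pi_apply k)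
    · choose C hC using fun k => (hf k).2.2
      refine ⟨∑ k, C k, fun ω i j => ?_⟩
      simp only [Matrix.sum_apply]
      exact (Finset.abs_sum_le_sum_abs _ _).trans (Finset.sum_le_sum fun k _ => hC k _ i j)
  intro n
  induction n with
  | zero =>
    intro Ω _ P _ f W h
    refine ⟨hgood _ f fun i => (h i).1, by simp, fun H hH => ?_⟩
    simp
  | succ n ih =>
    intro Ω _ P _ f W h
    have hg := hgood _ f fun i => (h i).1
    have hWs : ∀ {k} (g : Fin k → Matrix (Fin N) (Fin N) ℝ), (∀ i, (g i).IsHermitian) →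
        (∑ i, g i).IsHermitian := by
      intro k g hg
      rw [Matrix.IsHermitian, conjTranspose_sum]
      exact Finset.sum_congr rfl fun i _ => hg i
    refine ⟨hg, hWs _ fun i => (h i).2.1, fun H hH => ?_⟩
    have ih' := ih (fun j => P (Fin.succ j)) (fun j => f (Fin.succ j)) (fun j => W (Fin.succ j))
      fun i => h _
    have mp := measurePreserving_piFinSuccAbove P 0
    let F : Ω 0 × (∀ j : Fin n, Ω (Fin.succAbove 0 j)) → ℝ := fun z =>
      trace (NormedSpace.exp (H + (f 0 z.1 + ∑ j : Fin n, f (Fin.succAbove 0 j) (z.2 j))))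
    have hF : ∀ ω, trace (NormedSpace.exp (H + ∑ i, f i (ω i))) =
        F (MeasurableEquiv.piFinSuccAbove Ω 0 ω) := by
      intro ω
      simp only [F]
      rw [Fin.sum_univ_succ]
      rfl
    have hFint : Integrable F ((P 0).prod (Measure.pi fun j : Fin n => P (Fin.succAbove 0 j))) := by
      rw [← mp.integrable_comp_emb (MeasurableEquiv.measurableEmbedding _)]
      refine (hg.integrable (sm_cont_tr H)).congr (Filter.Eventually.of_forall fun ω => hF ω)
    calc ∫ ω, trace (NormedSpace.exp (H + ∑ i, f i (ω i))) ∂(Measure.pi P)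
        = ∫ ω, F (MeasurableEquiv.piFinSuccAbove Ω 0 ω) ∂(Measure.pi P) :=
          integral_congr_ae (Filter.Eventually.of_forall hF)
      _ = ∫ z, F z ∂((P 0).prod (Measure.pi fun j : Fin n => P (Fin.succAbove 0 j))) :=
          mp.integral_comp (MeasurableEquiv.measurableEmbedding _) F
      _ = ∫ a, ∫ b, F (a, b) ∂(Measure.pi fun j : Fin n => P (Fin.succAbove 0 j)) ∂(P 0) :=
          integral_prod _ hFint
      _ ≤ ∫ a, trace (NormedSpace.exp ((H + ∑ j : Fin n, W (Fin.succ j)) + f 0 a)) ∂(P 0) := by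
          refine integral_mono hFint.integral_prod_left ((h 0).1.integrable (sm_cont_tr _)) ?_
          intro a
          have := ih'.2.2 (H + f 0 a) (hH.add ((h 0).1.1 a))
          simp only [add_assoc] at this ⊢
          rw [add_comm (∑ j : Fin n, W (Fin.succ j)) (f 0 a)]
          exact this
      _ ≤ trace (NormedSpace.exp ((H + ∑ j : Fin n, W (Fin.succ j)) + W 0)) :=
          (h 0).2.2 _ (hH.add (hWs _ fun i => (h _).2.1))
      _ = trace (NormedSpace.exp (H + ∑ i, W i)) := by
          rw [Fin.sum_univ_succ, add_assoc, add_comm (W 0)]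

lemma sm_scalar_neg {x : ℝ} (hx : x ≤ 0) : Real.exp x ≤ 1 + x + x ^ 2 / 2 := by
  have hd : ∀ y : ℝ, HasDerivAt (fun y => 1 + y + y ^ 2 / 2 - Real.exp y)
      (1 + y - Real.exp y) y := by
    intro y
    have h := (((hasDerivAt_id y).const_add 1).add (((hasDerivAt_id y).pow 2).div_const 2)).sub
      (Real.hasDerivAt_exp y)
    refine h.congr_deriv ?_
    simp
  have hanti : Antitone (fun y => 1 + y + y ^ 2 / 2 - Real.exp y) := by
    refine antitone_of_deriv_nonpos (fun y => (hd y).differentiableAt) fun y => ?_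
    rw [(hd y).deriv]
    linarith [Real.add_one_le_exp y]
  have := hanti hx
  simp at this
  linarith

lemma sm_scalar_pos {x : ℝ} (hx : 0 ≤ x) (hx2 : x < 3 / 2) :
    Real.exp x ≤ 1 + x + x ^ 2 / (2 * (1 - 2 * x / 3)) := by
  have hq : ∀ y ∈ Set.Ico (0:ℝ) (3/2), 0 < 2 * (1 - 2 * y / 3) := by
    intro y hy; linarith [hy.2]
  have hd : ∀ y ∈ Set.Ico (0:ℝ) (3/2), HasDerivAt
      (fun y => (1 + y + y ^ 2 / (2 * (1 - 2 * y / 3))) * Real.exp (-y))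
      ((1 + (2 * y * (2 * (1 - 2 * y / 3)) - y ^ 2 * (- (4 / 3))) / (2 * (1 - 2 * y / 3)) ^ 2)
        * Real.exp (-y) + (1 + y + y ^ 2 / (2 * (1 - 2 * y / 3))) * (- Real.exp (-y))) y := by
    intro y hy
    have h0 : HasDerivAt (fun y : ℝ => 2 * (1 - 2 * y / 3)) (-(4/3)) y := by
      have h := ((((hasDerivAt_id y).const_mul 2).div_const 3).const_sub 1).const_mul 2
      refine h.congr_deriv ?_
      norm_num
    have h1 : HasDerivAt (fun y : ℝ => y ^ 2) (2 * y) y := by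
      simpa using hasDerivAt_pow 2 y
    have h2 := ((hasDerivAt_id y).const_add 1).add (h1.div h0 (hq y hy).ne')
    have h3 : HasDerivAt (fun y : ℝ => Real.exp (-y)) (- Real.exp (-y)) y := by
      simpa using (hasDerivAt_id y).neg.exp
    exact h2.mul h3
  have hmono : MonotoneOn (fun y => (1 + y + y ^ 2 / (2 * (1 - 2 * y / 3))) * Real.exp (-y))
      (Set.Ico (0:ℝ) (3/2)) := by
    refine monotoneOn_of_deriv_nonneg (convex_Ico _ _)
      (fun y hy => (hd y hy).continuousAt.continuousWithinAt)
      (fun y hy => (hd y (interior_subset hy)).differentiableAt.differentiableWithinAt) ?_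
    intro y hy
    have hy' := interior_subset hy
    rw [(hd y hy').deriv]
    have hq' := hq y hy'
    have h0 := hy'.1
    have : (1 + (2 * y * (2 * (1 - 2 * y / 3)) - y ^ 2 * (- (4 / 3))) / (2 * (1 - 2 * y / 3)) ^ 2)
        * Real.exp (-y) + (1 + y + y ^ 2 / (2 * (1 - 2 * y / 3))) * (- Real.exp (-y)) =
        Real.exp (-y) * (y * (2 - (1/2) * (2 * (1 - 2 * y / 3)) - (1/4) * (2 * (1 - 2 * y / 3))^2))
          / (2 * (1 - 2 * y / 3)) ^ 2 := by
      rw [eq_div_iff (by positivity)]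
      have : (2 * (1 - 2 * y / 3)) ≠ 0 := hq'.ne'
      have h3 : (1 - 2 * y / 3) ≠ 0 := by intro h; apply this; rw [h]; ring
      have h4 : (3 - 2 * y) ≠ 0 := by intro h; apply h3; linarith
      field_simp
      ring
    rw [this]
    have h5 : 0 ≤ 2 - (1/2) * (2 * (1 - 2 * y / 3)) - (1/4) * (2 * (1 - 2 * y / 3))^2 := by
      nlinarith [hy'.2]
    positivity
  have := hmono (Set.left_mem_Ico.mpr (by norm_num)) (Set.mem_Ico.mpr ⟨hx, hx2⟩) hx
  simp only [neg_zero, Real.exp_zero] at this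
  rw [Real.exp_neg, ← div_eq_mul_inv, le_div_iff₀ (Real.exp_pos _)] at this
  linarith

lemma sm_scalar {x b : ℝ} (hx : |x| ≤ b) (hb : b < 3 / 2) :
    Real.exp x ≤ 1 + x + 1 / (2 * (1 - 2 * b / 3)) * x ^ 2 := by
  have hb0 : 0 ≤ b := (abs_nonneg x).trans hx
  have hk : (0:ℝ) < 2 * (1 - 2 * b / 3) := by linarith
  rcases le_total x 0 with h | h
  · have h1 := sm_scalar_neg h
    have : 1 / 2 ≤ 1 / (2 * (1 - 2 * b / 3)) :=
      one_div_le_one_div_of_le hk (by linarith)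
    nlinarith [sq_nonneg x]
  · rw [abs_of_nonneg h] at hx
    have h1 := sm_scalar_pos h (by linarith)
    have : 1 / (2 * (1 - 2 * x / 3)) ≤ 1 / (2 * (1 - 2 * b / 3)) :=
      one_div_le_one_div_of_le hk (by linarith)
    have e : x ^ 2 / (2 * (1 - 2 * x / 3)) = 1 / (2 * (1 - 2 * x / 3)) * x ^ 2 := by ring
    rw [e] at h1
    nlinarith [sq_nonneg x]

lemma sm_quad_diag {N : ℕ} (U : Matrix (Fin N) (Fin N) ℝ) (h : Fin N → ℝ) (v : Fin N → ℝ) :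
    v ⬝ᵥ ((U * diagonal h * Uᵀ) *ᵥ v) = ∑ i, h i * (Uᵀ *ᵥ v) i ^ 2 := by
  rw [← mulVec_mulVec, ← mulVec_mulVec, dotProduct_mulVec, ← mulVec_transpose]
  simp only [dotProduct, mulVec_diagonal]
  refine Finset.sum_congr rfl fun i _ => ?_
  ring

lemma sm_eig {N : ℕ} {U : Matrix (Fin N) (Fin N) ℝ} (hU' : Uᵀ * U = 1) (h : Fin N → ℝ) (i : Fin N) :
    ∃ v : Fin N → ℝ, v ⬝ᵥ v = 1 ∧ v ⬝ᵥ ((U * diagonal h * Uᵀ) *ᵥ v) = h i := by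
  have e : Uᵀ *ᵥ (U *ᵥ Pi.single i (1:ℝ)) = Pi.single i 1 := by
    rw [mulVec_mulVec, hU', one_mulVec]
  refine ⟨U *ᵥ Pi.single i 1, ?_, ?_⟩
  · rw [dotProduct_mulVec, ← mulVec_transpose, e]
    simp
  · rw [sm_quad_diag, e]
    simp [Pi.single_apply]

lemma sm_dot_self {N : ℕ} {U : Matrix (Fin N) (Fin N) ℝ} (hU : U * Uᵀ = 1) (v : Fin N → ℝ) :
    v ⬝ᵥ v = ∑ i, (Uᵀ *ᵥ v) i ^ 2 := by
  have := sm_quad_diag U (fun _ => 1) v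
  have h1 : diagonal (fun _ : Fin N => (1:ℝ)) = 1 := by simp
  rw [h1, Matrix.mul_one, hU, one_mulVec] at this
  simpa using this

lemma sm_mgf {N : ℕ} {Ω : Type*} [MeasurableSpace Ω] {P : Measure Ω}
    [IsProbabilityMeasure P] {f : Ω → Matrix (Fin N) (Fin N) ℝ} (hf : SMGood f)
    (h0 : ∀ i j, ∫ ω, f ω i j ∂P = 0) {b : ℝ} (hb : b < 3 / 2)
    (hfb : ∀ ω v, |v ⬝ᵥ (f ω *ᵥ v)| ≤ b * (v ⬝ᵥ v))
    {V : Matrix (Fin N) (Fin N) ℝ} (hV : V.IsHermitian)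
    (hVe : ∀ i j, V i j = ∫ ω, (f ω * f ω) i j ∂P) :
    SMDom P f ((1 / (2 * (1 - 2 * b / 3))) • V) := by
  set κ := 1 / (2 * (1 - 2 * b / 3)) with hκ
  have hκV : (κ • V).IsHermitian := by
    rw [Matrix.IsHermitian, conjTranspose_smul, hV]; simp
  refine sm_dom_of_exp hf hκV fun v => ?_
  have hpt : ∀ ω, v ⬝ᵥ (NormedSpace.exp (f ω) *ᵥ v) ≤
      v ⬝ᵥ v + v ⬝ᵥ (f ω *ᵥ v) + κ * (v ⬝ᵥ ((f ω * f ω) *ᵥ v)) := by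
    intro ω
    obtain ⟨U, l, hU, hU', hA, eA⟩ := sm_spec (hf.1 ω)
    have hl : ∀ i, |l i| ≤ b := by
      intro i
      obtain ⟨u, hu1, hu2⟩ := sm_eig hU' l i
      have := hfb ω u
      rw [hA, hu2, hu1, mul_one] at this
      exact this
    have e2 : f ω * f ω = U * diagonal (fun i => l i ^ 2) * Uᵀ := by
      conv_lhs => rw [hA]
      have : U * diagonal l * Uᵀ * (U * diagonal l * Uᵀ) =
          U * (diagonal l * diagonal l) * Uᵀ := by
        simp only [Matrix.mul_assoc]
        rw [← Matrix.mul_assoc Uᵀ U, hU', Matrix.one_mul]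
      rw [this, diagonal_mul_diagonal]
      simp only [sq]
    rw [eA, e2, sm_quad_diag, sm_quad_diag, sm_dot_self hU]
    conv_rhs => rw [hA]
    rw [sm_quad_diag, Finset.mul_sum, ← Finset.sum_add_distrib, ← Finset.sum_add_distrib]
    refine Finset.sum_le_sum fun i _ => ?_
    have := mul_le_mul_of_nonneg_right (sm_scalar (hl i) hb) (sq_nonneg ((Uᵀ *ᵥ v) i))
    rw [← hκ] at this
    linarith
  have hcq : Continuous (fun A : Matrix (Fin N) (Fin N) ℝ => v ⬝ᵥ (A *ᵥ v)) :=
    continuous_const.dotProduct (continuous_id.matrix_mulVec continuous_const)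
  have hi1 : Integrable (fun ω => v ⬝ᵥ (NormedSpace.exp (f ω) *ᵥ v)) P :=
    hf.integrable (F := fun A => v ⬝ᵥ (NormedSpace.exp A *ᵥ v)) (hcq.comp (sm_exp_cont N))
  have hi2 : Integrable (fun ω => v ⬝ᵥ (f ω *ᵥ v)) P := hf.integrable hcq
  have hi3 : Integrable (fun ω => v ⬝ᵥ ((f ω * f ω) *ᵥ v)) P :=
    hf.integrable (F := fun A => v ⬝ᵥ ((A * A) *ᵥ v))
      (hcq.comp (continuous_id.matrix_mul continuous_id))
  have hlin : ∀ g : Ω → Matrix (Fin N) (Fin N) ℝ, (∀ i j, Integrable (fun ω => g ω i j) P) →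
      ∫ ω, v ⬝ᵥ (g ω *ᵥ v) ∂P = ∑ i, v i * ∑ j, (∫ ω, g ω i j ∂P) * v j := by
    intro g hg
    simp only [dotProduct, mulVec]
    have h1 : ∀ i j, Integrable (fun ω => g ω i j * v j) P :=
      fun i j => (hg i j).mul_const _
    have h2 : ∀ i, Integrable (fun ω => ∑ j, g ω i j * v j) P :=
      fun i => integrable_finsetSum _ fun j _ => h1 i j
    rw [integral_finsetSum _ fun i _ => (h2 i).const_mul (v i)]
    refine Finset.sum_congr rfl fun i _ => ?_
    rw [integral_const_mul, integral_finsetSum _ fun j _ => h1 i j]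
    congr 1
    refine Finset.sum_congr rfl fun j _ => ?_
    rw [integral_mul_const]
  have z1 : ∫ ω, v ⬝ᵥ (f ω *ᵥ v) ∂P = 0 := by
    rw [hlin f fun i j => hf.integrable (F := fun A => A i j) (continuous_id.matrix_elem i j)]
    simp [h0]
  have z2 : ∫ ω, v ⬝ᵥ ((f ω * f ω) *ᵥ v) ∂P = v ⬝ᵥ (V *ᵥ v) := by
    rw [hlin _ fun i j => hf.integrable (F := fun A => (A * A) i j)
      ((continuous_id.matrix_mul continuous_id).matrix_elem i j)]
    simp only [dotProduct, mulVec, hVe]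
  have step : ∫ ω, v ⬝ᵥ (NormedSpace.exp (f ω) *ᵥ v) ∂P ≤ v ⬝ᵥ v + κ * (v ⬝ᵥ (V *ᵥ v)) := by
    have hi4 : Integrable (fun ω => v ⬝ᵥ v + v ⬝ᵥ (f ω *ᵥ v)) P :=
      (integrable_const (v ⬝ᵥ v)).add hi2
    have hi5 : Integrable (fun ω => v ⬝ᵥ v + v ⬝ᵥ (f ω *ᵥ v) +
        κ * (v ⬝ᵥ ((f ω * f ω) *ᵥ v))) P := hi4.add (hi3.const_mul κ)
    have := integral_mono hi1 hi5 hpt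
    rw [integral_add hi4 (hi3.const_mul κ),
      integral_add (integrable_const _) hi2, z1, integral_const_mul, z2] at this
    simpa using this
  refine step.trans ?_
  obtain ⟨U, l, hU, hU', hA, eA⟩ := sm_spec hκV
  have : κ * (v ⬝ᵥ (V *ᵥ v)) = v ⬝ᵥ ((κ • V) *ᵥ v) := by
    rw [smul_mulVec, dotProduct_smul, smul_eq_mul]
  rw [this, eA]
  conv_lhs => rw [hA]
  rw [sm_quad_diag, sm_quad_diag, sm_dot_self hU, ← Finset.sum_add_distrib]
  refine Finset.sum_le_sum fun i _ => ?_
  nlinarith [Real.add_one_le_exp (l i), sq_nonneg ((Uᵀ *ᵥ v) i)]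

lemma sm_tr_conj {N : ℕ} {U : Matrix (Fin N) (Fin N) ℝ} (hU' : Uᵀ * U = 1) (l : Fin N → ℝ) :
    trace (U * diagonal l * Uᵀ) = ∑ i, l i := by
  rw [trace_mul_comm, ← Matrix.mul_assoc, hU', Matrix.one_mul, trace_diagonal]

lemma sm_trace_exp {N : ℕ} {W : Matrix (Fin N) (Fin N) ℝ} (hW : W.IsHermitian) {h : ℝ} (hh : 0 < h)
    (h0 : ∀ v, 0 ≤ v ⬝ᵥ (W *ᵥ v)) (h1 : ∀ v, v ⬝ᵥ (W *ᵥ v) ≤ h * (v ⬝ᵥ v)) :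
    trace (NormedSpace.exp W) ≤ N + trace W / h * (Real.exp h - 1) := by
  obtain ⟨U, l, hU, hU', hA, eA⟩ := sm_spec hW
  rw [eA, sm_tr_conj hU']
  conv_rhs => rw [hA]
  rw [sm_tr_conj hU', Finset.sum_div, Finset.sum_mul]
  have : (N : ℝ) = ∑ i : Fin N, 1 := by simp
  rw [this, ← Finset.sum_add_distrib]
  refine Finset.sum_le_sum fun i _ => ?_
  obtain ⟨u, hu1, hu2⟩ := sm_eig hU' l i
  have a0 := h0 u
  have a1 := h1 u
  rw [hA, hu2] at a0 a1
  rw [hu1, mul_one] at a1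
  have ha : 0 ≤ 1 - l i / h := by rw [sub_nonneg, div_le_one hh]; exact a1
  have hb : 0 ≤ l i / h := by positivity
  have := convexOn_exp.2 (Set.mem_univ 0) (Set.mem_univ h) ha hb (by ring)
  simp only [smul_eq_mul, mul_zero, zero_add, Real.exp_zero, mul_one] at this
  rw [div_mul_cancel₀ _ hh.ne'] at this
  linarith

lemma sm_norm_lt {N : ℕ} {U : Matrix (Fin N) (Fin N) ℝ} (hU : U * Uᵀ = 1) (hU' : Uᵀ * U = 1)
    {l : Fin N → ℝ} {ε : ℝ} (hε : 0 < ε) (hl : ∀ i, |l i| < ε) :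
    specNorm (U * diagonal l * Uᵀ) < ε := by
  open scoped Matrix.Norms.L2Operator in
  have e : specNorm (U * diagonal l * Uᵀ) = ‖U * diagonal l * Uᵀ‖ :=
    (Matrix.l2_opNorm_toEuclideanCLM _)
  open scoped Matrix.Norms.L2Operator in
  have hn1 : ‖U‖ ≤ 1 := by
    have := Matrix.l2_opNorm_conjTranspose_mul_self U
    rw [conjTranspose_eq_transpose_of_trivial, hU'] at this
    have h2 : ‖(1 : Matrix (Fin N) (Fin N) ℝ)‖ ≤ 1 := by
      rw [← Matrix.diagonal_one, Matrix.l2_opNorm_diagonal]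
      refine (pi_norm_le_iff_of_nonneg zero_le_one).mpr fun i => ?_
      simp
    nlinarith [norm_nonneg U]
  open scoped Matrix.Norms.L2Operator in
  have hn2 : ‖Uᵀ‖ ≤ 1 := by
    rw [← conjTranspose_eq_transpose_of_trivial, Matrix.l2_opNorm_conjTranspose]
    exact hn1
  open scoped Matrix.Norms.L2Operator in
  have hd : ‖(diagonal l : Matrix (Fin N) (Fin N) ℝ)‖ < ε := by
    rw [Matrix.l2_opNorm_diagonal]
    exact (pi_norm_lt_iff hε).mpr hl
  rw [e]
  open scoped Matrix.Norms.L2Operator in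
  calc ‖U * diagonal l * Uᵀ‖ ≤ ‖U‖ * ‖(diagonal l : Matrix (Fin N) (Fin N) ℝ)‖ * ‖Uᵀ‖ :=
        (Matrix.l2_opNorm_mul _ _).trans
          (mul_le_mul_of_nonneg_right (Matrix.l2_opNorm_mul _ _) (norm_nonneg _))
    _ ≤ 1 * ‖(diagonal l : Matrix (Fin N) (Fin N) ℝ)‖ * 1 := by gcongr
    _ < ε := by simpa using hd

lemma sm_quad_le_norm {N : ℕ} (A : Matrix (Fin N) (Fin N) ℝ) (v : Fin N → ℝ) :
    v ⬝ᵥ (A *ᵥ v) ≤ specNorm A * (v ⬝ᵥ v) := by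
  have h1 : v ⬝ᵥ (A *ᵥ v) = inner ℝ (WithLp.toLp 2 v) (Matrix.toEuclideanCLM (𝕜 := ℝ) A (WithLp.toLp 2 v)) := by
    simp [PiLp.inner_apply, dotProduct, mul_comm]
  have h2 : v ⬝ᵥ v = ‖(WithLp.toLp 2 v : EuclideanSpace ℝ (Fin N))‖ ^ 2 := by
    rw [EuclideanSpace.norm_sq_eq]
    simp [dotProduct, sq]
  rw [h1, h2]
  refine (real_inner_le_norm _ _).trans ?_
  have := (Matrix.toEuclideanCLM (𝕜 := ℝ) A).le_opNorm (WithLp.toLp 2 v)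
  unfold specNorm
  nlinarith [norm_nonneg (WithLp.toLp 2 v : EuclideanSpace ℝ (Fin N))]

lemma sm_exp_conj {N : ℕ} {U : Matrix (Fin N) (Fin N) ℝ} (hU : U * Uᵀ = 1) (l : Fin N → ℝ) :
    NormedSpace.exp (U * diagonal l * Uᵀ) = U * diagonal (fun i => Real.exp (l i)) * Uᵀ := by
  have hinv : U⁻¹ = Uᵀ := inv_eq_right_inv hU
  have hu : IsUnit U := (isUnit_iff_isUnit_det U).mpr (isUnit_det_of_right_inverse hU)
  rw [← hinv, Matrix.exp_conj _ _ hu, Matrix.exp_diagonal]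
  congr 3
  funext i
  rw [Pi.coe_exp, Real.exp_eq_exp_ℝ]

lemma sm_cosh_pos (x : ℝ) : 0 ≤ Real.exp x + Real.exp (-x) - 2 := by
  have h := Real.exp_pos x
  rw [Real.exp_neg]
  have : Real.exp x + (Real.exp x)⁻¹ - 2 = (Real.exp x - 1) ^ 2 / Real.exp x := by
    field_simp; ring
  rw [this]; positivity

lemma sm_cosh_mono {x y : ℝ} (hx : 0 ≤ x) (hxy : x ≤ |y|) :
    Real.exp x + Real.exp (-x) - 2 ≤ Real.exp y + Real.exp (-y) - 2 := by
  have h := Real.cosh_le_cosh.mpr (show |x| ≤ |y| by rwa [abs_of_nonneg hx])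
  rw [Real.cosh_eq, Real.cosh_eq] at h
  linarith

lemma sm_final {n E p : ℝ} (hn : 1 ≤ n) (hE : 1 < E) (hn2 : n = 1 ∨ 2 ≤ n) (hp1 : p ≤ 1)
    (hp0 : 0 ≤ p)
    (h : (E ^ 2 + (E ^ 2)⁻¹ - 2) * p ≤ (n - 1) * (E - 1)) : p ≤ n * E⁻¹ := by
  have hE0 : 0 < E := by linarith
  rw [← div_eq_mul_inv, le_div_iff₀ hE0]
  rcases lt_or_ge E n with h1 | h1
  · nlinarith
  have e : E ^ 2 + (E ^ 2)⁻¹ - 2 = (E ^ 2 - 1) ^ 2 / E ^ 2 := by field_simp; ring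
  rw [e, div_mul_eq_mul_div, div_le_iff₀ (by positivity)] at h
  have hE1 : 0 < E - 1 := by linarith
  have h2 : (E - 1) * (E + 1) ^ 2 * p ≤ (n - 1) * E ^ 2 := by
    have : (E - 1) * ((E - 1) * (E + 1) ^ 2 * p) ≤ (E - 1) * ((n - 1) * E ^ 2) := by nlinarith
    exact le_of_mul_le_mul_left this hE1
  rcases hn2 with hn2 | hn2
  · subst hn2
    have : p = 0 := by
      have : 0 < (E - 1) * (E + 1) ^ 2 := by positivity
      nlinarith
    rw [this]; norm_num
  · have h3 : (n - 1) * E ^ 3 ≤ n * ((E - 1) * (E + 1) ^ 2) := by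
      have : 0 ≤ E ^ 2 - E - 1 + 0 := by nlinarith
      nlinarith [mul_le_mul_of_nonneg_left h1 (sq_nonneg E), mul_nonneg (by linarith : (0:ℝ) ≤ n) this, sq_nonneg E, pow_pos hE0 3]
    have h4 : 0 < (E - 1) * (E + 1) ^ 2 := by positivity
    have h5 : ((E - 1) * (E + 1) ^ 2) * (p * E) ≤ ((E - 1) * (E + 1) ^ 2) * n := by
      nlinarith
    exact le_of_mul_le_mul_left h5 h4

lemma sm_bern {N : ℕ} (hN : 1 ≤ N) {Ω : Type*} [MeasurableSpace Ω] {P : Measure Ω}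
    [IsProbabilityMeasure P] {S : Ω → Matrix (Fin N) (Fin N) ℝ} {θ ε t : ℝ}
    (hθ : 0 < θ) (hε : 0 < ε) (ht : 0 < t) (hte : θ * ε = 2 * t) {W : Matrix (Fin N) (Fin N) ℝ}
    (h1 : SMDom P (fun ω => θ • S ω) W) (h2 : SMDom P (fun ω => (-θ) • S ω) W)
    (hW0 : ∀ v, 0 ≤ v ⬝ᵥ (W *ᵥ v)) (hW1 : ∀ v, v ⬝ᵥ (W *ᵥ v) ≤ t * (v ⬝ᵥ v))
    (htr : trace W ≤ t * (((N : ℝ) - 1) / 2)) :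
    P {ω | ε ≤ specNorm (S ω)} ≤ ENNReal.ofReal (N * Real.exp (-t)) := by
  have hN' : (1:ℝ) ≤ N := by exact_mod_cast hN
  have hH : (0 : Matrix (Fin N) (Fin N) ℝ).IsHermitian := isHermitian_zero
  have i1 := h1.2.2 0 hH
  have i2 := h2.2.2 0 hH
  have g1 := h1.1.integrable (P := P) (sm_cont_tr 0)
  have g2 := h2.1.integrable (P := P) (sm_cont_tr 0)
  simp only [zero_add] at i1 i2 g1 g2
  have hexp := sm_trace_exp h1.2.1 ht hW0 hW1
  have het : 1 < Real.exp t := by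
    rw [← Real.exp_zero]; exact Real.exp_lt_exp.mpr ht
  have hW2 : trace (NormedSpace.exp W) ≤ N + (((N : ℝ) - 1) / 2) * (Real.exp t - 1) := by
    refine hexp.trans ?_
    have : trace W / t ≤ ((N : ℝ) - 1) / 2 := by rw [div_le_iff₀ ht]; linarith
    have := mul_le_mul_of_nonneg_right this (by linarith : 0 ≤ Real.exp t - 1)
    linarith
  let F : Ω → ℝ := fun ω => ((NormedSpace.exp (θ • S ω)).trace +
    (NormedSpace.exp ((-θ) • S ω)).trace) - 2 * N
  have hF : ∀ ω, 0 ≤ F ω ∧ (ε ≤ specNorm (S ω) →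
      Real.exp (2 * t) + Real.exp (-(2 * t)) - 2 ≤ F ω) := by
    intro ω
    have hS : (S ω).IsHermitian := by
      have := h1.1.1 ω
      have e : S ω = θ⁻¹ • (θ • S ω) := by rw [smul_smul, inv_mul_cancel₀ hθ.ne', one_smul]
      rw [e, Matrix.IsHermitian, conjTranspose_smul, this]; simp
    obtain ⟨U, l, hU, hU', hA, -⟩ := sm_spec hS
    have ex : ∀ c : ℝ, (NormedSpace.exp (c • S ω)).trace = ∑ i, Real.exp (c * l i) := by
      intro c
      have : c • S ω = U * diagonal (fun i => c * l i) * Uᵀ := by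
        rw [hA]
        have : (diagonal fun i => c * l i) = c • diagonal l := by
          ext i j; simp [diagonal_apply]
        rw [this]; simp
      rw [this, sm_exp_conj hU, sm_tr_conj hU']
    have eF : F ω = ∑ i, (Real.exp (θ * l i) + Real.exp (-(θ * l i)) - 2) := by
      simp only [F, ex, Finset.sum_sub_distrib, Finset.sum_add_distrib]
      simp [mul_comm]
    have hp : ∀ i ∈ Finset.univ, 0 ≤ (Real.exp (θ * l i) + Real.exp (-(θ * l i)) - 2) :=
      fun i _ => sm_cosh_pos _
    refine ⟨eF ▸ Finset.sum_nonneg hp, fun hs => ?_⟩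
    have : ∃ i, ε ≤ |l i| := by
      by_contra! hc
      have := sm_norm_lt hU hU' hε hc
      rw [← hA] at this
      linarith
    obtain ⟨i, hi⟩ := this
    rw [eF]
    refine le_trans ?_ (Finset.single_le_sum hp (Finset.mem_univ i))
    refine sm_cosh_mono (by positivity) ?_
    rw [← hte, abs_mul, abs_of_pos hθ]
    exact mul_le_mul_of_nonneg_left hi hθ.le
  have g3 : Integrable (fun ω => (NormedSpace.exp (θ • S ω)).trace +
    (NormedSpace.exp ((-θ) • S ω)).trace) P := g1.add g2
  have hFi : Integrable F P := g3.sub (integrable_const _)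
  have hFint : ∫ ω, F ω ∂P ≤ ((N : ℝ) - 1) * (Real.exp t - 1) := by
    simp only [F]
    rw [integral_sub g3 (integrable_const _), integral_add g1 g2]
    simp only [integral_const, probReal_univ, one_smul]
    linarith
  have mk := mul_meas_ge_le_integral_of_nonneg (Filter.Eventually.of_forall fun ω => (hF ω).1) hFi
    (Real.exp (2 * t) + Real.exp (-(2 * t)) - 2)
  have hsub : P {ω | ε ≤ specNorm (S ω)} ≤
      P {ω | Real.exp (2 * t) + Real.exp (-(2 * t)) - 2 ≤ F ω} :=
    measure_mono fun ω hω => (hF ω).2 hω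
  refine hsub.trans ?_
  rw [← ofReal_measureReal]
  apply ENNReal.ofReal_le_ofReal
  rw [Real.exp_neg t]
  have e2 : Real.exp (2 * t) = Real.exp t ^ 2 := by rw [two_mul, Real.exp_add, sq]
  set p := P.real {ω | Real.exp (2 * t) + Real.exp (-(2 * t)) - 2 ≤ F ω} with hp
  have hp1 : p ≤ 1 := measureReal_le_one
  have hp0 : 0 ≤ p := measureReal_nonneg
  have hmk : (Real.exp (2 * t) + Real.exp (-(2 * t)) - 2) * p ≤ _ := mk.trans hFint
  clear_value p
  rw [Real.exp_neg, e2] at hmk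
  refine sm_final hN' het ?_ hp1 hp0 hmk
  rcases hN.eq_or_lt with h | h
  · left; rw [← h]; simp
  · right; exact_mod_cast h

lemma sm_int_quad {N : ℕ} {Ω : Type*} [MeasurableSpace Ω] {P : Measure Ω}
    {g : Ω → Matrix (Fin N) (Fin N) ℝ} (hg : ∀ i j, Integrable (fun ω => g ω i j) P)
    {K : Matrix (Fin N) (Fin N) ℝ} (hK : ∀ i j, K i j = ∫ ω, g ω i j ∂P) (v : Fin N → ℝ) :
    v ⬝ᵥ (K *ᵥ v) = ∫ ω, v ⬝ᵥ (g ω *ᵥ v) ∂P := by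
  simp only [dotProduct, mulVec]
  have h1 : ∀ i j, Integrable (fun ω => g ω i j * v j) P :=
    fun i j => (hg i j).mul_const _
  have h2 : ∀ i, Integrable (fun ω => ∑ j, g ω i j * v j) P :=
    fun i => integrable_finsetSum _ fun j _ => h1 i j
  rw [integral_finsetSum _ fun i _ => (h2 i).const_mul (v i)]
  refine Finset.sum_congr rfl fun i _ => ?_
  rw [integral_const_mul, integral_finsetSum _ fun j _ => h1 i j]
  congr 1
  refine Finset.sum_congr rfl fun j _ => ?_
  rw [integral_mul_const, hK]

noncomputable def smY {N : ℕ} (a : Fin N → ℝ) : Matrix (Fin N) (Fin N) ℝ :=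
  Matrix.of fun i j => Real.cos (a i - a j)

lemma smY_mulVec {N : ℕ} (a v : Fin N → ℝ) (i : Fin N) : (smY a *ᵥ v) i =
    Real.cos (a i) * (∑ j, v j * Real.cos (a j)) + Real.sin (a i) * (∑ j, v j * Real.sin (a j)) := by
  simp only [mulVec, dotProduct, smY, Matrix.of_apply, Finset.mul_sum, ← Finset.sum_add_distrib,
    Real.cos_sub]
  refine Finset.sum_congr rfl fun j _ => ?_
  ring

lemma smY_quad {N : ℕ} (a v : Fin N → ℝ) : v ⬝ᵥ (smY a *ᵥ v) =
    (∑ j, v j * Real.cos (a j)) ^ 2 + (∑ j, v j * Real.sin (a j)) ^ 2 := by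
  simp only [dotProduct, smY_mulVec]
  rw [sq, sq, Finset.sum_mul, Finset.sum_mul, ← Finset.sum_add_distrib]
  refine Finset.sum_congr rfl fun j _ => ?_
  ring

lemma smY_herm {N : ℕ} (a : Fin N → ℝ) : (smY a).IsHermitian := by
  ext i j
  simp only [smY, conjTranspose_apply, Matrix.of_apply, star_trivial]
  rw [← Real.cos_neg, neg_sub]

lemma sm_herm_sq {N : ℕ} {A : Matrix (Fin N) (Fin N) ℝ} (hA : A.IsHermitian) (v : Fin N → ℝ) :
    v ⬝ᵥ ((A * A) *ᵥ v) = (A *ᵥ v) ⬝ᵥ (A *ᵥ v) := by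
  have : Aᵀ = A := by simpa [Matrix.IsHermitian] using hA
  rw [← mulVec_mulVec, dotProduct_mulVec, ← mulVec_transpose, this]

lemma sm_dot_nonneg {N : ℕ} (v : Fin N → ℝ) : 0 ≤ v ⬝ᵥ v :=
  Finset.sum_nonneg fun i _ => mul_self_nonneg _

lemma smY_sq {N : ℕ} (a v : Fin N → ℝ) :
    v ⬝ᵥ ((smY a * smY a) *ᵥ v) ≤ N * (v ⬝ᵥ (smY a *ᵥ v)) := by
  rw [sm_herm_sq (smY_herm a), smY_quad]
  simp only [dotProduct, smY_mulVec]
  set C := ∑ j, v j * Real.cos (a j)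
  set S := ∑ j, v j * Real.sin (a j)
  calc _ ≤ ∑ i : Fin N, (C ^ 2 + S ^ 2) := by
        refine Finset.sum_le_sum fun i _ => ?_
        have := Real.sin_sq_add_cos_sq (a i)
        have e : (C ^ 2 + S ^ 2) = (C ^ 2 + S ^ 2) * (Real.sin (a i) ^ 2 + Real.cos (a i) ^ 2) := by
          rw [this, mul_one]
        rw [e]
        nlinarith [sq_nonneg (Real.cos (a i) * S - Real.sin (a i) * C)]
    _ = N * (C ^ 2 + S ^ 2) := by simp; ring

lemma smY_le {N : ℕ} (a v : Fin N → ℝ) : v ⬝ᵥ (smY a *ᵥ v) ≤ N * (v ⬝ᵥ v) := by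
  have h1 := smY_sq a v
  rw [sm_herm_sq (smY_herm a)] at h1
  have h2 : (v ⬝ᵥ (smY a *ᵥ v)) ^ 2 ≤ (v ⬝ᵥ v) * ((smY a *ᵥ v) ⬝ᵥ (smY a *ᵥ v)) := by
    have := Finset.sum_mul_sq_le_sq_mul_sq Finset.univ v (smY a *ᵥ v)
    simpa [dotProduct, sq] using this
  have h3 : 0 ≤ v ⬝ᵥ (smY a *ᵥ v) := by rw [smY_quad]; positivity
  have h0 := sm_dot_nonneg v
  rcases h3.eq_or_lt with h | h
  · rw [← h]; positivity
  · have : (v ⬝ᵥ (smY a *ᵥ v)) * (v ⬝ᵥ (smY a *ᵥ v)) ≤ (N * (v ⬝ᵥ v)) * (v ⬝ᵥ (smY a *ᵥ v)) := by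
      nlinarith [mul_le_mul_of_nonneg_left h1 h0]
    exact le_of_mul_le_mul_right this h

lemma smY_good {N : ℕ} {Ω : Type*} [MeasurableSpace Ω] {a : Ω → Fin N → ℝ}
    (ha : ∀ i, Measurable fun ω => a ω i) : SMGood fun ω => smY (a ω) := by
  refine ⟨fun ω => smY_herm _, fun i j => ?_, 1, fun ω i j => Real.abs_cos_le_one _⟩
  exact Real.measurable_cos.comp ((ha i).sub (ha j))

lemma sm_comp {N : ℕ} {Ω : Type*} [MeasurableSpace Ω] {P : Measure Ω}
    [IsProbabilityMeasure P] {a : Ω → Fin N → ℝ} (ha : ∀ i, Measurable fun ω => a ω i)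
    {K : Matrix (Fin N) (Fin N) ℝ} (hK : ∀ i j, K i j = ∫ ω, smY (a ω) i j ∂P)
    (hvar : ∀ i j, ∫ ω, smY (a ω) i j ^ 2 ∂P - K i j ^ 2 ≤ 1 / 2) :
    ∃ V : Matrix (Fin N) (Fin N) ℝ, V.IsHermitian ∧ (∀ v, 0 ≤ v ⬝ᵥ (V *ᵥ v)) ∧
      (∀ v, v ⬝ᵥ (V *ᵥ v) ≤ N * (v ⬝ᵥ (K *ᵥ v))) ∧ trace V ≤ N * (N - 1) / 2 ∧
      ∀ α b : ℝ, |α| * N ≤ b → b < 3 / 2 →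
        SMDom P (fun ω => α • (smY (a ω) - K)) ((1 / (2 * (1 - 2 * b / 3))) • (α ^ 2 • V)) := by
  have hg := smY_good ha
  have hKh : K.IsHermitian := by
    ext i j
    rw [conjTranspose_apply, star_trivial, hK, hK]
    congr 1; funext ω
    have := (smY_herm (a ω)).apply j i
    simpa using this.symm
  have hint : ∀ i j, Integrable (fun ω => smY (a ω) i j) P := fun i j =>
    hg.integrable (F := fun A => A i j) (continuous_id.matrix_elem i j)
  have hint2 : ∀ i j, Integrable (fun ω => (smY (a ω) * smY (a ω)) i j) P := fun i j =>
    hg.integrable (F := fun A => (A * A) i j)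
      ((continuous_id.matrix_mul continuous_id).matrix_elem i j)
  have hcc : Continuous (fun A : Matrix (Fin N) (Fin N) ℝ => (A - K) * (A - K)) :=
    (continuous_id.sub continuous_const).matrix_mul (continuous_id.sub continuous_const)
  have hint3 : ∀ i j, Integrable (fun ω => ((smY (a ω) - K) * (smY (a ω) - K)) i j) P := fun i j =>
    hg.integrable (F := fun A => ((A - K) * (A - K)) i j) (hcc.matrix_elem i j)
  have hKl : ∀ v, v ⬝ᵥ (K *ᵥ v) ≤ N * (v ⬝ᵥ v) := by
    intro v
    rw [sm_int_quad hint hK]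
    have hi : Integrable (fun ω => v ⬝ᵥ (smY (a ω) *ᵥ v)) P :=
      hg.integrable (F := fun A => v ⬝ᵥ (A *ᵥ v))
        (continuous_const.dotProduct (continuous_id.matrix_mulVec continuous_const))
    have := integral_mono hi (integrable_const (N * (v ⬝ᵥ v))) fun ω => smY_le (a ω) v
    simpa using this
  have hK0 : ∀ v, 0 ≤ v ⬝ᵥ (K *ᵥ v) := by
    intro v
    rw [sm_int_quad hint hK]
    exact integral_nonneg fun ω => by rw [smY_quad]; positivity
  let V : Matrix (Fin N) (Fin N) ℝ := Matrix.of fun i j =>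
    ∫ ω, ((smY (a ω) - K) * (smY (a ω) - K)) i j ∂P
  have hVe : ∀ i j, V i j = ∫ ω, (smY (a ω) * smY (a ω)) i j ∂P - (K * K) i j := by
    intro i j
    have e : ∀ ω, ((smY (a ω) - K) * (smY (a ω) - K)) i j =
        (smY (a ω) * smY (a ω)) i j -
          (∑ k, smY (a ω) i k * K k j + ∑ k, K i k * smY (a ω) k j) + (K * K) i j := by
      intro ω
      rw [Matrix.sub_mul, Matrix.mul_sub, Matrix.mul_sub]
      simp only [Matrix.sub_apply, ← Matrix.mul_apply]
      ring
    have ha1 : Integrable (fun ω => ∑ k, smY (a ω) i k * K k j) P :=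
      integrable_finsetSum _ fun k _ => (hint i k).mul_const _
    have ha2 : Integrable (fun ω => ∑ k, K i k * smY (a ω) k j) P :=
      integrable_finsetSum _ fun k _ => (hint k j).const_mul _
    have ha3 : Integrable (fun ω => ∑ k, smY (a ω) i k * K k j + ∑ k, K i k * smY (a ω) k j) P :=
      ha1.add ha2
    have ha4 : Integrable (fun ω => (smY (a ω) * smY (a ω)) i j -
          (∑ k, smY (a ω) i k * K k j + ∑ k, K i k * smY (a ω) k j)) P := (hint2 i j).sub ha3
    simp only [V, Matrix.of_apply, e]
    rw [integral_add ha4 (integrable_const _), integral_sub (hint2 i j) ha3, integral_add ha1 ha2,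
      integral_finsetSum _ fun k _ => (hint i k).mul_const _,
      integral_finsetSum _ fun k _ => (hint k j).const_mul _]
    simp only [integral_mul_const, integral_const_mul, ← hK, ← Matrix.mul_apply]
    simp only [integral_const, probReal_univ, one_smul]
    ring
  have hVh : V.IsHermitian := by
    ext i j
    rw [conjTranspose_apply, star_trivial]
    simp only [V, Matrix.of_apply]
    congr 1; funext ω
    have hs : (smY (a ω) - K).IsHermitian := (smY_herm _).sub hKh
    have h2 : ((smY (a ω) - K) * (smY (a ω) - K)).IsHermitian := by
      rw [Matrix.IsHermitian, conjTranspose_mul, hs]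
    simpa using (h2.apply j i).symm
  refine ⟨V, hVh, fun v => ?_, fun v => ?_, ?_, ?_⟩
  · rw [sm_int_quad hint3 (K := V) (fun i j => rfl)]
    refine integral_nonneg fun ω => ?_
    have hs : (smY (a ω) - K).IsHermitian := (smY_herm _).sub hKh
    simp only [sm_herm_sq hs]
    exact sm_dot_nonneg _
  · have e1 : V = (Matrix.of fun i j => ∫ ω, (smY (a ω) * smY (a ω)) i j ∂P) - K * K := by
      ext i j; exact hVe i j
    rw [e1, sub_mulVec, dotProduct_sub, sm_herm_sq hKh]
    have h0 := sm_dot_nonneg (K *ᵥ v)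
    rw [sm_int_quad hint2 (K := Matrix.of fun i j => ∫ ω, (smY (a ω) * smY (a ω)) i j ∂P)
      (fun i j => rfl), sm_int_quad hint hK v]
    have hi : Integrable (fun ω => v ⬝ᵥ (smY (a ω) *ᵥ v)) P :=
      hg.integrable (F := fun A => v ⬝ᵥ (A *ᵥ v))
        (continuous_const.dotProduct (continuous_id.matrix_mulVec continuous_const))
    have hi2 : Integrable (fun ω => v ⬝ᵥ ((smY (a ω) * smY (a ω)) *ᵥ v)) P :=
      hg.integrable (F := fun A => v ⬝ᵥ ((A * A) *ᵥ v))
        (continuous_const.dotProduct ((continuous_id.matrix_mul continuous_id).matrix_mulVec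
          continuous_const))
    have := integral_mono hi2 (hi.const_mul N) fun ω => smY_sq (a ω) v
    rw [integral_const_mul] at this
    linarith
  · have hint4 : ∀ i j, Integrable (fun ω => smY (a ω) i j ^ 2) P := fun i j =>
      hg.integrable (F := fun A => A i j ^ 2) ((continuous_id.matrix_elem i j).pow 2)
    have hd : ∀ i, V i i = ∑ j, (∫ ω, smY (a ω) i j ^ 2 ∂P - K i j ^ 2) := by
      intro i
      rw [hVe, Matrix.mul_apply, Finset.sum_sub_distrib]
      simp only [Matrix.mul_apply]
      have s1 : ∀ ω j, smY (a ω) i j * smY (a ω) j i = smY (a ω) i j ^ 2 := by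
        intro ω j
        have := (smY_herm (a ω)).apply i j
        rw [star_trivial] at this
        rw [this, sq]
      have s2 : ∀ j, K i j * K j i = K i j ^ 2 := by
        intro j
        have := hKh.apply i j
        rw [star_trivial] at this
        rw [this, sq]
      simp only [s1, s2]
      rw [integral_finsetSum _ fun j _ => hint4 i j]
    have hb : ∀ i j, (∫ ω, smY (a ω) i j ^ 2 ∂P - K i j ^ 2) ≤ 1 / 2 - if i = j then 1 / 2 else 0 := by
      intro i j
      by_cases hij : i = j
      · subst hij
        rw [hK]
        simp [smY]
      · simpa [hij] using hvar i j
    calc trace V = ∑ i, ∑ j, (∫ ω, smY (a ω) i j ^ 2 ∂P - K i j ^ 2) := by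
          simp only [trace, diag_apply, hd]
      _ ≤ ∑ i : Fin N, ∑ j : Fin N, ((1:ℝ) / 2 - if i = j then 1 / 2 else 0) :=
          Finset.sum_le_sum fun i _ => Finset.sum_le_sum fun j _ => hb i j
      _ = N * (N - 1) / 2 := by
          simp
          ring
  · intro α b hb1 hb2
    have hgf : SMGood (fun ω => α • (smY (a ω) - K)) := by
      refine ⟨fun ω => ?_, fun i j => ?_, ?_⟩
      · rw [Matrix.IsHermitian, conjTranspose_smul, ((smY_herm _).sub hKh)]; simp
      · simp only [Matrix.smul_apply, Matrix.sub_apply, smul_eq_mul]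
        exact ((hg.2.1 i j).sub_const _).const_mul _
      · have := hg.bounded (F := fun A => ∑ i, ∑ j, |(α • (A - K)) i j|) ?_
        · obtain ⟨C, hC⟩ := this
          refine ⟨C, fun ω i j => le_trans ?_ ((le_abs_self _).trans (hC ω))⟩
          refine le_trans ?_ (Finset.single_le_sum (fun i _ => Finset.sum_nonneg fun j _ => abs_nonneg _) (Finset.mem_univ i))
          exact (Finset.single_le_sum (f := fun j => |(α • (smY (a ω) - K)) i j|) (fun j _ => abs_nonneg _) (Finset.mem_univ j))
        · refine continuous_finsetSum _ fun i _ => continuous_finsetSum _ fun j _ => ?_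
          exact (((continuous_id.sub continuous_const).const_smul α).matrix_elem i j).abs
    refine sm_mgf hgf ?_ hb2 ?_ ?_ ?_
    · intro i j
      simp only [Matrix.smul_apply, Matrix.sub_apply, smul_eq_mul]
      rw [integral_const_mul, integral_sub (hint i j) (integrable_const _), ← hK]
      simp
    · intro ω v
      rw [smul_mulVec, dotProduct_smul, smul_eq_mul, sub_mulVec, dotProduct_sub, abs_mul]
      have h1 : |v ⬝ᵥ smY (a ω) *ᵥ v - v ⬝ᵥ K *ᵥ v| ≤ N * (v ⬝ᵥ v) := by
        have a1 := smY_le (a ω) v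
        have a2 : 0 ≤ v ⬝ᵥ (smY (a ω) *ᵥ v) := by rw [smY_quad]; positivity
        have a3 := hKl v
        have a4 := hK0 v
        rw [abs_le]; constructor <;> linarith
      calc _ ≤ |α| * (N * (v ⬝ᵥ v)) := by gcongr
        _ = (|α| * N) * (v ⬝ᵥ v) := by ring
        _ ≤ _ := mul_le_mul_of_nonneg_right hb1 (sm_dot_nonneg v)
    · rw [Matrix.IsHermitian, conjTranspose_smul, hVh]; simp
    · intro i j
      simp only [Matrix.smul_mul, Matrix.mul_smul, Matrix.smul_apply, smul_eq_mul]
      rw [integral_const_mul, integral_const_mul, sq, mul_assoc]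
      rfl

lemma sm_cosE {D : ℕ} (μ σ τ : Fin D → ℝ) (u : Fin D → NNReal)
    (hv : ∀ d, (u d : ℝ) = σ d ^ 2) :
    ∫ s, Real.cos (2 * π * ∑ d, s d * τ d)
      ∂(Measure.pi fun d => gaussianReal (μ d) (u d)) =
    Real.exp (-2 * π ^ 2 * ∑ d, σ d ^ 2 * τ d ^ 2) * Real.cos (2 * π * ∑ d, μ d * τ d) := by
  set P := (Measure.pi fun d => gaussianReal (μ d) (u d)) with hP
  have h1 : ∫ s, Complex.exp ((2 * π * ∑ d, s d * τ d : ℝ) * Complex.I) ∂P =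
      Complex.exp ((-2 * π ^ 2 * ∑ d, σ d ^ 2 * τ d ^ 2 : ℝ) +
        (2 * π * ∑ d, μ d * τ d : ℝ) * Complex.I) := by
    have e : ∀ s : Fin D → ℝ, Complex.exp ((2 * π * ∑ d, s d * τ d : ℝ) * Complex.I) =
        ∏ d, Complex.exp (((2 * π * τ d : ℝ) : ℂ) * (s d : ℂ) * Complex.I) := by
      intro s
      rw [← Complex.exp_sum]
      congr 1
      push_cast
      rw [Finset.mul_sum, Finset.sum_mul]
      refine Finset.sum_congr rfl fun d _ => ?_
      ring
    simp only [e]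
    rw [hP, integral_fintype_prod_eq_prod (fun d (z : ℝ) =>
      Complex.exp (((2 * π * τ d : ℝ) : ℂ) * (z : ℂ) * Complex.I))]
    simp only [← charFun_apply_real, charFun_gaussianReal]
    rw [← Complex.exp_sum]
    congr 1
    push_cast
    rw [Finset.mul_sum, Finset.mul_sum, Finset.sum_mul, ← Finset.sum_add_distrib]
    refine Finset.sum_congr rfl fun d _ => ?_
    have : ((u d : ℝ) : ℂ) = (σ d : ℂ) ^ 2 := by
      rw [hv]; push_cast; rfl
    rw [this]
    ring
  have hint : Integrable (fun s : Fin D → ℝ =>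
      Complex.exp ((2 * π * ∑ d, s d * τ d : ℝ) * Complex.I)) P := by
    refine Integrable.of_bound (C := 1) ?_ (Filter.Eventually.of_forall fun s => ?_)
    · exact Continuous.aestronglyMeasurable (by fun_prop)
    · rw [Complex.norm_exp_ofReal_mul_I]
  have h2 := integral_re hint
  rw [h1] at h2
  simp only [RCLike.re_to_complex, Complex.exp_ofReal_mul_I_re] at h2
  rw [h2, Complex.exp_add, ← Complex.ofReal_exp, Complex.re_ofReal_mul,
    Complex.exp_ofReal_mul_I_re]

lemma sm_varE {D : ℕ} (μ σ τ : Fin D → ℝ) (u : Fin D → NNReal)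
    (hv : ∀ d, (u d : ℝ) = σ d ^ 2) :
    ∫ s, Real.cos (2 * π * ∑ d, s d * τ d) ^ 2
      ∂(Measure.pi fun d => gaussianReal (μ d) (u d)) -
    (Real.exp (-2 * π ^ 2 * ∑ d, σ d ^ 2 * τ d ^ 2) * Real.cos (2 * π * ∑ d, μ d * τ d)) ^ 2
      ≤ 1 / 2 := by
  have e : ∀ s : Fin D → ℝ, Real.cos (2 * π * ∑ d, s d * τ d) ^ 2 =
      1 / 2 + 1 / 2 * Real.cos (2 * π * ∑ d, s d * (2 * τ d)) := by
    intro s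
    have : 2 * π * ∑ d, s d * (2 * τ d) = 2 * (2 * π * ∑ d, s d * τ d) := by
      rw [mul_left_comm 2 (2 * π), Finset.mul_sum Finset.univ (fun d => s d * τ d) 2]
      congr 1
      refine Finset.sum_congr rfl fun d _ => ?_
      ring
    rw [this, Real.cos_two_mul]
    ring
  simp only [e]
  rw [integral_add (integrable_const _), integral_const_mul, sm_cosE _ σ _ u hv]
  · have s1 : ∑ d, σ d ^ 2 * (2 * τ d) ^ 2 = 4 * ∑ d, σ d ^ 2 * τ d ^ 2 := by
      rw [Finset.mul_sum]; exact Finset.sum_congr rfl fun d _ => by ring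
    have s2 : ∑ d, μ d * (2 * τ d) = 2 * ∑ d, μ d * τ d := by
      rw [Finset.mul_sum]; exact Finset.sum_congr rfl fun d _ => by ring
    rw [s1, s2]
    set A := ∑ d, σ d ^ 2 * τ d ^ 2 with hA
    have hA0 : 0 ≤ A := Finset.sum_nonneg fun d _ => by positivity
    set y := 2 * π * ∑ d, μ d * τ d with hy
    have e1 : 2 * π * (2 * ∑ d, μ d * τ d) = 2 * y := by rw [hy]; ring
    rw [e1, Real.cos_two_mul]
    set E := Real.exp (-2 * π ^ 2 * A) with hE
    have hE0 : 0 < E := Real.exp_pos _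
    have hE1 : E ≤ 1 := Real.exp_le_one_iff.mpr (by
      have : 0 ≤ π ^ 2 * A := by positivity
      linarith)
    have e2 : Real.exp (-2 * π ^ 2 * (4 * A)) = E ^ 4 := by
      rw [hE, ← Real.exp_nat_mul]; congr 1; push_cast; ring
    rw [e2]
    simp only [integral_const, probReal_univ, one_smul]
    have h4 : E ^ 4 ≤ E ^ 2 := pow_le_pow_of_le_one hE0.le hE1 (by norm_num)
    have h5 : E ^ 4 * Real.cos y ^ 2 ≤ E ^ 2 * Real.cos y ^ 2 :=
      mul_le_mul_of_nonneg_right h4 (sq_nonneg _)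
    nlinarith [pow_pos hE0 4]
  · refine Integrable.const_mul ?_ _
    refine Integrable.of_bound (C := 1) ?_ (Filter.Eventually.of_forall fun s => ?_)
    · exact Continuous.aestronglyMeasurable (by fun_prop)
    · exact Real.abs_cos_le_one _

noncomputable def smK {D N : ℕ} (μ σ : Fin D → ℝ) (x : Fin N → Fin D → ℝ) :
    Matrix (Fin N) (Fin N) ℝ :=
  Matrix.of fun i j => Real.exp (-2 * π ^ 2 * ∑ d, σ d ^ 2 * (x i d - x j d) ^ 2) *
    Real.cos (2 * π * ∑ d, μ d * (x i d - x j d))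

noncomputable def smA {D N : ℕ} (x : Fin N → Fin D → ℝ) (s : Fin D → ℝ) : Fin N → ℝ :=
  fun k => 2 * π * ∑ d, s d * x k d

lemma smA_sub {D N : ℕ} (x : Fin N → Fin D → ℝ) (s : Fin D → ℝ) (i j : Fin N) :
    smA x s i - smA x s j = 2 * π * ∑ d, s d * (x i d - x j d) := by
  simp only [smA, mul_sub, Finset.sum_sub_distrib]

lemma sm_model {D N : ℕ} (μ σ : Fin D → ℝ) (u : Fin D → NNReal)
    (hu : ∀ d, (u d : ℝ) = σ d ^ 2) (x : Fin N → Fin D → ℝ) :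
    ∃ V : Matrix (Fin N) (Fin N) ℝ, V.IsHermitian ∧ (∀ v, 0 ≤ v ⬝ᵥ (V *ᵥ v)) ∧
      (∀ v, v ⬝ᵥ (V *ᵥ v) ≤ N * (v ⬝ᵥ (smK μ σ x *ᵥ v))) ∧ trace V ≤ N * (N - 1) / 2 ∧
      ∀ α b : ℝ, |α| * N ≤ b → b < 3 / 2 →
        SMDom (Measure.pi fun d => gaussianReal (μ d) (u d))
          (fun ω => α • (smY (smA x ω) - smK μ σ x))
          ((1 / (2 * (1 - 2 * b / 3))) • (α ^ 2 • V)) := by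
  refine sm_comp ?_ ?_ ?_
  · intro i
    unfold smA
    fun_prop
  · intro i j
    simp only [smY, Matrix.of_apply, smA_sub, smK]
    rw [sm_cosE μ σ (fun d => x i d - x j d) u hu]
  · intro i j
    simp only [smY, Matrix.of_apply, smA_sub, smK]
    exact sm_varE μ σ (fun d => x i d - x j d) u hu

lemma sm_kSM {Q D N : ℕ} (w : Fin Q → ℝ) (μ σ : Fin Q → Fin D → ℝ) (x : Fin N → Fin D → ℝ) :
    (Matrix.of fun i j : Fin N => kSM w μ σ (x i - x j)) = ∑ q, w q • smK (μ q) (σ q) x := by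
  ext i j
  rw [Matrix.sum_apply]
  simp only [Matrix.of_apply, kSM, smK, Matrix.smul_apply, smul_eq_mul, Pi.sub_apply, mul_assoc]

lemma sm_decomp {Q D N : ℕ} (w : Fin Q → ℝ) (hw : ∀ q, 0 ≤ w q) (μ σ : Fin Q → Fin D → ℝ)
    (m : Fin Q → ℕ) (hm : ∀ q, 0 < m q) (x : Fin N → Fin D → ℝ)
    (s : (q : Fin Q) → Fin (m q) → Fin D → ℝ) :
    ((Matrix.of fun i j : Fin N =>
              ∑ t, phiSM w m s (x i) t * phiSM w m s (x j) t) -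
            Matrix.of fun i j : Fin N => kSM w μ σ (x i - x j)) =
    ∑ q, ∑ i, (w q / m q) • (smY (smA x (s q i)) - smK (μ q) (σ q) x) := by
  have h1 : (Matrix.of fun i j : Fin N => ∑ t, phiSM w m s (x i) t * phiSM w m s (x j) t) =
      ∑ q, ∑ i, (w q / m q) • smY (smA x (s q i)) := by
    ext k l
    simp only [Matrix.sum_apply, Matrix.of_apply, Matrix.smul_apply, smul_eq_mul]
    rw [Fintype.sum_prod_type, Fintype.sum_sigma]
    refine Finset.sum_congr rfl fun q _ => Finset.sum_congr rfl fun i _ => ?_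
    simp only [Fintype.sum_bool, phiSM, smY, smA, Matrix.of_apply, Real.cos_sub]
    have e1 : Real.sqrt (w q) * Real.sqrt (w q) = w q := Real.mul_self_sqrt (hw q)
    have e2 : (Real.sqrt (m q))⁻¹ * (Real.sqrt (m q))⁻¹ = (m q : ℝ)⁻¹ := by
      rw [← mul_inv, Real.mul_self_sqrt (Nat.cast_nonneg _)]
    have e3 : w q / m q = (Real.sqrt (w q) * Real.sqrt (w q)) *
      ((Real.sqrt (m q))⁻¹ * (Real.sqrt (m q))⁻¹) := by rw [e1, e2]; rfl
    rw [e3]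
    simp
    ring
  have h2 : (∑ q, w q • smK (μ q) (σ q) x) =
      ∑ q, ∑ _i : Fin (m q), (w q / m q) • smK (μ q) (σ q) x := by
    refine Finset.sum_congr rfl fun q _ => ?_
    rw [Finset.sum_const, Finset.card_univ, Fintype.card_fin, ← Nat.cast_smul_eq_nsmul ℝ,
      smul_smul, mul_div_cancel₀]
    exact_mod_cast (hm q).ne'
  rw [h1, sm_kSM, h2]
  simp only [smul_sub, Finset.sum_sub_distrib]

lemma sm_specNorm_zero {N : ℕ} : specNorm (0 : Matrix (Fin N) (Fin N) ℝ) = 0 := by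
  simp [specNorm]

lemma sm_main (Q D N : ℕ) (hQ : 0 < Q)
    (w : Fin Q → ℝ) (hw : ∀ q, 0 ≤ w q) (μ σ : Fin Q → Fin D → ℝ)
    (u : Fin Q → Fin D → NNReal) (hu : ∀ q d, (u q d : ℝ) = σ q d ^ 2)
    (m : Fin Q → ℕ) (hm : ∀ q, 0 < m q)
    (x : Fin N → Fin D → ℝ) (ε : ℝ) (hε : 0 < ε) :
    (Measure.pi fun q => Measure.pi fun _ : Fin (m q) =>
        Measure.pi fun d => gaussianReal (μ q d) (u q d))
      {s | ε ≤ specNorm ((Matrix.of fun i j : Fin N =>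
              ∑ t, phiSM w m s (x i) t * phiSM w m s (x j) t) -
            Matrix.of fun i j : Fin N => kSM w μ σ (x i - x j))} ≤
      ENNReal.ofReal (N * Real.exp
        (-3 * ε ^ 2 * (Nat.cast (sInf (Set.range m)) : ℝ) /
          (Real.sqrt (∑ q, w q ^ 2) * N *
            (6 * specNorm (Matrix.of fun i j : Fin N => kSM w μ σ (x i - x j)) + 4 * ε)))) := by
  simp only [sm_decomp w hw μ σ m hm x]
  have key0 : (∀ s : (q : Fin Q) → Fin (m q) → Fin D → ℝ,
      ∑ q, ∑ i, (w q / m q) • (smY (smA x (s q i)) - smK (μ q) (σ q) x) = 0) →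
      {s : (q : Fin Q) → Fin (m q) → Fin D → ℝ | ε ≤ specNorm
        (∑ q, ∑ i, (w q / m q) • (smY (smA x (s q i)) - smK (μ q) (σ q) x))} = ∅ := by
    intro h
    ext s
    simp only [Set.mem_ofPred_eq, Set.mem_empty_iff_false, iff_false, not_le, h s,
      sm_specNorm_zero]
    exact hε
  rcases Nat.eq_zero_or_pos N with hN | hN
  · subst hN
    rw [key0 fun s => Subsingleton.elim _ _]
    simp
  set W0 := Real.sqrt (∑ q, w q ^ 2) with hW0
  have hW0n : 0 ≤ W0 := Real.sqrt_nonneg _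
  have hsq : W0 ^ 2 = ∑ q, w q ^ 2 := Real.sq_sqrt (Finset.sum_nonneg fun q _ => sq_nonneg _)
  have hwW : ∀ q, w q ≤ W0 := fun q => Real.le_sqrt_of_sq_le
    (Finset.single_le_sum (f := fun q => w q ^ 2) (fun q _ => sq_nonneg _) (Finset.mem_univ q))
  rcases hW0n.eq_or_lt with h0 | hW0p
  · have hw0 : ∀ q, w q = 0 := fun q => le_antisymm (h0 ▸ hwW q) (hw q)
    rw [key0 fun s => by simp [hw0]]
    simp
  set K := (Matrix.of fun i j : Fin N => kSM w μ σ (x i - x j)) with hK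
  set n : ℝ := (Nat.cast (sInf (Set.range m)) : ℝ) with hn
  have hnm : ∀ q, n ≤ m q := fun q => by
    rw [hn]; exact_mod_cast Nat.sInf_le (Set.mem_range_self q)
  have hnp : 0 < n := by
    rw [hn]
    have : sInf (Set.range m) ∈ Set.range m := Nat.sInf_mem ⟨m ⟨0, hQ⟩, Set.mem_range_self _⟩
    obtain ⟨q, hq⟩ := this
    rw [← hq]; exact_mod_cast hm q
  have hNp : (0:ℝ) < N := by exact_mod_cast hN
  have hN1 : (1:ℝ) ≤ N := by exact_mod_cast hN
  set NK := specNorm K with hNK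
  have hsumw : W0 ≤ ∑ q, w q := by
    have hs : 0 ≤ ∑ q, w q := Finset.sum_nonneg fun q _ => hw q
    refine Real.sqrt_le_iff.mpr ⟨hs, ?_⟩
    rw [sq (∑ q, w q), Finset.sum_mul]
    refine Finset.sum_le_sum fun q _ => ?_
    rw [sq]
    exact mul_le_mul_of_nonneg_left
      (Finset.single_le_sum (fun q _ => hw q) (Finset.mem_univ q)) (hw q)
  have hNKW : W0 ≤ NK := by
    have := sm_quad_le_norm K (Pi.single (⟨0, hN⟩ : Fin N) 1)
    have e : (Pi.single (⟨0, hN⟩ : Fin N) (1:ℝ)) ⬝ᵥ (K *ᵥ (Pi.single (⟨0, hN⟩ : Fin N) (1:ℝ))) =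
        ∑ q, w q := by
      simp [hK, kSM]
    have e2 : (Pi.single (⟨0, hN⟩ : Fin N) (1:ℝ)) ⬝ᵥ (Pi.single (⟨0, hN⟩ : Fin N) (1:ℝ)) = 1 := by
      simp
    rw [e, e2, mul_one] at this
    exact hsumw.trans this
  have hNKp : 0 < NK := hW0p.trans_le hNKW
  -- parameters
  obtain ⟨L, hL⟩ : ∃ L, L = N * W0 / n := ⟨_, rfl⟩
  have hLp : 0 < L := by rw [hL]; positivity
  obtain ⟨θ, hθ⟩ : ∃ θ, θ = ε / (L * (NK + 2 / 3 * ε)) := ⟨_, rfl⟩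
  have hθp : 0 < θ := by rw [hθ]; positivity
  obtain ⟨t, ht⟩ : ∃ t, t = θ * ε / 2 := ⟨_, rfl⟩
  have htp : 0 < t := by rw [ht]; positivity
  obtain ⟨b, hb⟩ : ∃ b, b = θ * L := ⟨_, rfl⟩
  have hb' : b = ε / (NK + 2 / 3 * ε) := by rw [hb, hθ]; field_simp
  have hb32 : b < 3 / 2 := by
    rw [hb', div_lt_iff₀ (by positivity)]; linarith
  obtain ⟨κ, hκ⟩ : ∃ κ, κ = 1 / (2 * (1 - 2 * b / 3)) := ⟨_, rfl⟩
  have hκ' : κ = (NK + 2 / 3 * ε) / (2 * NK) := by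
    have : 1 - 2 * b / 3 = NK / (NK + 2 / 3 * ε) := by
      rw [hb']; field_simp; ring
    rw [hκ, this]; field_simp
  have hκp : 0 < κ := by rw [hκ']; positivity
  have hκt : κ * θ ^ 2 * L * NK = t := by
    rw [hκ', ht, hθ]; field_simp
  have hexp : -3 * ε ^ 2 * n / (W0 * N * (6 * NK + 4 * ε)) = -t := by
    rw [ht, hθ, hL]
    field_simp
    ring
  rw [hexp]
  choose V hVh hV0 hV1 hVt hVd using fun q => sm_model (μ q) (σ q) (u q) (hu q) x
  have hmp : ∀ q, (0:ℝ) < m q := fun q => by exact_mod_cast hm q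
  have hwm : ∀ q, w q / m q ≤ W0 / n := fun q => by
    have := hnm q
    have := hwW q
    gcongr
  have hα : ∀ q, θ * (w q / m q) * N ≤ b := by
    intro q
    rw [hb, hL]
    have := mul_le_mul_of_nonneg_left (hwm q) (mul_nonneg hθp.le hNp.le)
    calc θ * (w q / m q) * N = θ * N * (w q / m q) := by ring
      _ ≤ θ * N * (W0 / n) := this
      _ = _ := by ring
  have hwm0 : ∀ q, 0 ≤ w q / m q := fun q => div_nonneg (hw q) (hmp q).le
  let W : Matrix (Fin N) (Fin N) ℝ :=
    ∑ q, ∑ _i : Fin (m q), κ • ((θ * (w q / m q)) ^ 2 • V q)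
  have hdom : ∀ c : ℝ, (c = θ ∨ c = -θ) → SMDom (Measure.pi fun q => Measure.pi fun _ : Fin (m q) =>
        Measure.pi fun d => gaussianReal (μ q d) (u q d))
      (fun s => c • ∑ q, ∑ i, (w q / m q) • (smY (smA x (s q i)) - smK (μ q) (σ q) x)) W := by
    intro c hc
    have hc2 : ∀ q, (c * (w q / m q)) ^ 2 = (θ * (w q / m q)) ^ 2 := by
      intro q; rcases hc with rfl | rfl <;> ring
    have hcab : ∀ q, |c * (w q / m q)| = θ * (w q / m q) := by
      intro q
      rw [abs_mul, abs_of_nonneg (hwm0 q)]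
      rcases hc with rfl | rfl
      · rw [abs_of_pos hθp]
      · rw [abs_neg, abs_of_pos hθp]
    have d1 : ∀ q, SMDom (Measure.pi fun d => gaussianReal (μ q d) (u q d))
        (fun ω => (c * (w q / m q)) • (smY (smA x ω) - smK (μ q) (σ q) x))
        (κ • ((θ * (w q / m q)) ^ 2 • V q)) := by
      intro q
      have := hVd q (c * (w q / m q)) b (by rw [hcab]; exact hα q) hb32
      rw [hc2, ← hκ] at this
      exact this
    have d2 := fun q => sm_dom_pi (m q) _ _ _ fun _ : Fin (m q) => d1 q
    have d3 := sm_dom_pi Q _ _ _ d2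
    have e : (fun s : (q : Fin Q) → Fin (m q) → Fin D → ℝ =>
        c • ∑ q, ∑ i, (w q / m q) • (smY (smA x (s q i)) - smK (μ q) (σ q) x)) =
        fun s => ∑ q, ∑ i, (c * (w q / m q)) • (smY (smA x (s q i)) - smK (μ q) (σ q) x) := by
      funext s
      simp only [Finset.smul_sum, smul_smul]
    rw [e]
    exact d3
  have hWe : W = ∑ q, (κ * θ ^ 2 * (w q ^ 2 / m q)) • V q := by
    refine Finset.sum_congr rfl fun q _ => ?_
    rw [Finset.sum_const, Finset.card_univ, Fintype.card_fin, ← Nat.cast_smul_eq_nsmul ℝ,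
      smul_smul, smul_smul]
    congr 1
    have := (hmp q).ne'
    field_simp
  have hWq : ∀ v, v ⬝ᵥ (W *ᵥ v) = ∑ q, (κ * θ ^ 2 * (w q ^ 2 / m q)) * (v ⬝ᵥ (V q *ᵥ v)) := by
    intro v
    rw [hWe, sum_mulVec, dotProduct_sum]
    refine Finset.sum_congr rfl fun q _ => ?_
    rw [smul_mulVec, dotProduct_smul, smul_eq_mul]
  have hKq : ∀ v, v ⬝ᵥ (K *ᵥ v) = ∑ q, w q * (v ⬝ᵥ (smK (μ q) (σ q) x *ᵥ v)) := by
    intro v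
    rw [hK, sm_kSM, sum_mulVec, dotProduct_sum]
    refine Finset.sum_congr rfl fun q _ => ?_
    rw [smul_mulVec, dotProduct_smul, smul_eq_mul]
  have hco : ∀ q, 0 ≤ κ * θ ^ 2 * (w q ^ 2 / m q) := fun q => by
    have := hmp q
    positivity
  refine sm_bern hN hθp hε htp (by rw [ht]; ring) (hdom θ (Or.inl rfl)) (hdom (-θ) (Or.inr rfl))
    (fun v => ?_) (fun v => ?_) ?_
  · rw [hWq]
    exact Finset.sum_nonneg fun q _ => mul_nonneg (hco q) (hV0 q v)
  · rw [hWq]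
    calc _ ≤ ∑ q, κ * θ ^ 2 * L * (w q * (v ⬝ᵥ (smK (μ q) (σ q) x *ᵥ v))) := by
          refine Finset.sum_le_sum fun q _ => ?_
          refine (mul_le_mul_of_nonneg_left (hV1 q v) (hco q)).trans ?_
          have hk : 0 ≤ v ⬝ᵥ (smK (μ q) (σ q) x *ᵥ v) :=
            nonneg_of_mul_nonneg_right ((hV0 q v).trans (hV1 q v)) hNp
          have h1 : w q ^ 2 / m q * N ≤ L * w q := by
            have := mul_le_mul_of_nonneg_left (hwm q) (mul_nonneg (hw q) hNp.le)
            calc w q ^ 2 / m q * N = w q * N * (w q / m q) := by ring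
              _ ≤ w q * N * (W0 / n) := this
              _ = L * w q := by rw [hL]; ring
          have h2 := mul_le_mul_of_nonneg_left (mul_le_mul_of_nonneg_right h1 hk)
            (show 0 ≤ κ * θ ^ 2 by positivity)
          calc _ = κ * θ ^ 2 * (w q ^ 2 / m q * N * (v ⬝ᵥ (smK (μ q) (σ q) x *ᵥ v))) := by ring
            _ ≤ _ := h2
            _ = _ := by ring
      _ = κ * θ ^ 2 * L * (v ⬝ᵥ (K *ᵥ v)) := by rw [hKq, Finset.mul_sum]
      _ ≤ κ * θ ^ 2 * L * (NK * (v ⬝ᵥ v)) :=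
          mul_le_mul_of_nonneg_left (sm_quad_le_norm K v) (by positivity)
      _ = t * (v ⬝ᵥ v) := by rw [← hκt]; ring
  · rw [hWe, trace_sum]
    simp only [trace_smul, smul_eq_mul]
    have hN2 : (0:ℝ) ≤ N * (N - 1) / 2 := by
      have : (0:ℝ) ≤ N - 1 := by linarith
      positivity
    calc _ ≤ ∑ q, κ * θ ^ 2 * (w q ^ 2 / n) * (N * (N - 1) / 2) := by
          refine Finset.sum_le_sum fun q _ => ?_
          refine (mul_le_mul_of_nonneg_left (hVt q) (hco q)).trans ?_
          refine mul_le_mul_of_nonneg_right ?_ hN2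
          have := hnm q
          gcongr
      _ = κ * θ ^ 2 * (W0 ^ 2 / n) * (N * (N - 1) / 2) := by
          rw [hsq, ← Finset.sum_mul, ← Finset.mul_sum, Finset.sum_div]
      _ = κ * θ ^ 2 * L * W0 * ((N - 1) / 2) := by rw [hL]; ring
      _ ≤ κ * θ ^ 2 * L * NK * ((N - 1) / 2) := by
          have : (0:ℝ) ≤ (N - 1) / 2 := by linarith
          gcongr
      _ = _ := by rw [hκt]

end SMHelpers

/-- Proposition 1: concentration of the random feature Gram matrix `Φ Φᵀ` around the exact SM
kernel Gram matrix `K_SM(X, X)` in spectral norm, where `W₀ = (Σ_q w_q²)^{1/2}` and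
`m₀ = min_q m_q`. -/
theorem phiSM_gram_concentration (Q D N : ℕ) (hQ : 0 < Q) (hD : 0 < D)
    (w : Fin Q → ℝ) (hw : ∀ q, 0 ≤ w q) (μ σ : Fin Q → Fin D → ℝ)
    (hσ : ∀ q d, 0 < σ q d) (m : Fin Q → ℕ) (hm : ∀ q, 0 < m q)
    (x : Fin N → Fin D → ℝ) (ε : ℝ) (hε : 0 < ε) :
    (Measure.pi fun q => Measure.pi fun _ : Fin (m q) =>
        Measure.pi fun d => gaussianReal (μ q d) ⟨σ q d ^ 2, sq_nonneg _⟩)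
      {s | ε ≤ specNorm ((Matrix.of fun i j : Fin N =>
              ∑ t, phiSM w m s (x i) t * phiSM w m s (x j) t) -
            Matrix.of fun i j : Fin N => kSM w μ σ (x i - x j))} ≤
      ENNReal.ofReal (N * Real.exp
        (-3 * ε ^ 2 * (Nat.cast (sInf (Set.range m)) : ℝ) /
          (Real.sqrt (∑ q, w q ^ 2) * N *
            (6 * specNorm (Matrix.of fun i j : Fin N => kSM w μ σ (x i - x j)) + 4 * ε)))) := by
  exact sm_main Q D N hQ w hw μ σ (fun q d => ⟨σ q d ^ 2, sq_nonneg _⟩) (fun q d => rfl) m hm x ε hε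
end

section
/- Let Q, D be positive integers, and for q = 1,…,Q let w_q ≥ 0, μ_q ∈ ℝ^D, σ_q ∈ ℝ^D with positive coordinates, and m_q a positive integer. Let the spectral points s_{q,i} be independent random vectors with s_{q,i} having independent coordinates distributed as N(μ_{q,d}, σ_{q,d}²). Fix x_1, x_2 ∈ ℝ^D and set τ = x_1 − x_2. Let Z = Σ_{q=1}^{Q} (w_q / m_q) Σ_{i=1}^{m_q} cos(2π ⟨s_{q,i}, τ⟩), which equals the (1,2) entry ⟨φ_SM(x_1; s), φ_SM(x_2; s)⟩ of the random feature Gram matrix. Then Var(Z) = Σ_{q=1}^{Q} (w_q² / m_q) · [ (1 + k_q(2τ))/2 − k_q(τ)² ], where k_q(τ) = exp(−2π² Σ_{d=1}^{D} σ_{q,d}² τ_d²) cos(2π ⟨μ_q, τ⟩). -/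
open MeasureTheory ProbabilityTheory Real

/-- The `q`-th SM kernel component `k_q(τ) = exp(−2π² Σ_d σ_{q,d}² τ_d²) cos(2π ⟨μ_q, τ⟩)`. -/
noncomputable def kGauss {D : ℕ} (μ σ : Fin D → ℝ) (τ : Fin D → ℝ) : ℝ :=
  Real.exp (-2 * π ^ 2 * ∑ d, σ d ^ 2 * τ d ^ 2) * Real.cos (2 * π * ∑ d, μ d * τ d)

/-- The square of a real number as a nonnegative real. -/
noncomputable def sqN (x : ℝ) : NNReal := ⟨x ^ 2, sq_nonneg x⟩

lemma aux_mean {D : ℕ} (μ σ τ : Fin D → ℝ) :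
    ∫ s, Real.cos (2 * π * ∑ d, s d * τ d)
      ∂(Measure.pi fun d => gaussianReal (μ d) (sqN (σ d))) = kGauss μ σ τ := by
  set P := Measure.pi fun d => gaussianReal (μ d) (sqN (σ d)) with hP
  have h1 : ∫ s, ∏ d, Complex.exp ((2 * π * τ d : ℝ) * (s d : ℝ) * Complex.I) ∂P
      = ∏ d, Complex.exp ((2 * π * τ d : ℝ) * μ d * Complex.I
          - ((σ d ^ 2 : ℝ) : ℂ) * (2 * π * τ d : ℝ) ^ 2 / 2) := by
    rw [hP, integral_fintype_prod_eq_prod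
      (f := fun d (x : ℝ) => Complex.exp ((2 * π * τ d : ℝ) * (x : ℝ) * Complex.I))]
    refine Finset.prod_congr rfl fun d _ => ?_
    rw [← charFun_apply_real, charFun_gaussianReal]
    rfl
  have h2 : ∀ s : Fin D → ℝ, Real.cos (2 * π * ∑ d, s d * τ d)
      = (∏ d, Complex.exp ((2 * π * τ d : ℝ) * (s d : ℝ) * Complex.I)).re := by
    intro s
    rw [← Complex.exp_sum, ← Complex.exp_ofReal_mul_I_re]
    congr 2
    push_cast
    rw [Finset.mul_sum, Finset.sum_mul]
    exact Finset.sum_congr rfl fun d _ => by ring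
  have hint : Integrable (fun s : Fin D → ℝ =>
      ∏ d, Complex.exp ((2 * π * τ d : ℝ) * (s d : ℝ) * Complex.I)) P := by
    refine Integrable.of_bound (C := 1) (Continuous.aestronglyMeasurable (by fun_prop)) (ae_of_all _ fun s => ?_)
    rw [← Complex.exp_sum, ← Finset.sum_mul]
    have : (∑ d, ((2 * π * τ d : ℝ) : ℂ) * (s d : ℝ)) = ((∑ d, (2 * π * τ d) * s d : ℝ) : ℂ) := by
      push_cast; rfl
    rw [this, Complex.norm_exp_ofReal_mul_I]
  simp_rw [h2]
  have h3 := integral_re hint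
  simp only [RCLike.re_eq_complex_re] at h3
  rw [h3, h1, ← Complex.exp_sum, Complex.exp_re, kGauss]
  congr 2
  · rw [Complex.re_sum, Finset.mul_sum]
    refine Finset.sum_congr rfl fun d _ => ?_
    rw [show ((2 * π * τ d : ℝ) : ℂ) * μ d * Complex.I
          - ((σ d ^ 2 : ℝ) : ℂ) * (2 * π * τ d : ℝ) ^ 2 / 2
        = ((-2 * π ^ 2 * (σ d ^ 2 * τ d ^ 2) : ℝ) : ℂ) + ((2 * π * τ d * μ d : ℝ) : ℂ) * Complex.I by
        push_cast; ring, Complex.add_re, Complex.ofReal_re, Complex.re_ofReal_mul, Complex.I_re]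
    ring
  · rw [Complex.im_sum, Finset.mul_sum]
    refine Finset.sum_congr rfl fun d _ => ?_
    rw [show ((2 * π * τ d : ℝ) : ℂ) * μ d * Complex.I
          - ((σ d ^ 2 : ℝ) : ℂ) * (2 * π * τ d : ℝ) ^ 2 / 2
        = ((-2 * π ^ 2 * (σ d ^ 2 * τ d ^ 2) : ℝ) : ℂ) + ((2 * π * τ d * μ d : ℝ) : ℂ) * Complex.I by
        push_cast; ring, Complex.add_im, Complex.ofReal_im, Complex.im_ofReal_mul, Complex.I_im]
    ring

lemma aux_var {D : ℕ} (μ σ τ : Fin D → ℝ) :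
    variance (fun s : Fin D → ℝ => Real.cos (2 * π * ∑ d, s d * τ d))
      (Measure.pi fun d => gaussianReal (μ d) (sqN (σ d)))
      = (1 + kGauss μ σ (2 • τ)) / 2 - kGauss μ σ τ ^ 2 := by
  have hb (t : Fin D → ℝ) (p) : MemLp (fun s : Fin D → ℝ => Real.cos (2 * π * ∑ d, s d * t d)) p
      (Measure.pi fun d => gaussianReal (μ d) (sqN (σ d))) :=
    MemLp.of_bound (Continuous.aestronglyMeasurable (by fun_prop)) 1 (ae_of_all _ fun s => Real.abs_cos_le_one _)
  rw [variance_eq_sub (hb τ 2), aux_mean]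
  congr 1
  have : ∀ s : Fin D → ℝ, ((fun s : Fin D → ℝ => Real.cos (2 * π * ∑ d, s d * τ d)) ^ 2) s
      = (1 + Real.cos (2 * π * ∑ d, s d * (2 • τ) d)) / 2 := by
    intro s
    have e : 2 * π * ∑ d, s d * (2 • τ) d = 2 * (2 * π * ∑ d, s d * τ d) := by
      simp only [Finset.mul_sum, Pi.smul_apply, nsmul_eq_mul]
      exact Finset.sum_congr rfl fun d _ => by push_cast; ring
    rw [e, Real.cos_two_mul]
    simp only [Pi.pow_apply]
    ring
  simp_rw [this]
  rw [integral_div, integral_add (integrable_const _) (memLp_one_iff_integrable.1 (hb _ 1)), aux_mean]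
  simp

/-- With independent spectral points `s q i` having independent coordinates
`N(μ q d, (σ q d)^2)`, and `τ = x₁ − x₂`, the random variable
`Z = Σ_q (w_q / m_q) Σ_i cos(2π ⟨s_{q,i}, τ⟩)` equals the Gram matrix entry
`⟨φ_SM(x₁; s), φ_SM(x₂; s)⟩`, and its variance is
`Σ_q (w_q² / m_q) [(1 + k_q(2τ))/2 − k_q(τ)²]`. -/
theorem variance_gram_entry (Q D : ℕ) (hQ : 0 < Q) (hD : 0 < D)
    (w : Fin Q → ℝ) (hw : ∀ q, 0 ≤ w q) (μ σ : Fin Q → Fin D → ℝ)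
    (hσ : ∀ q d, 0 < σ q d) (m : Fin Q → ℕ) (hm : ∀ q, 0 < m q)
    (x₁ x₂ : Fin D → ℝ) (τ : Fin D → ℝ) (hτ : τ = x₁ - x₂)
    (Z : ((q : Fin Q) → Fin (m q) → Fin D → ℝ) → ℝ)
    (hZ : ∀ s, Z s = ∑ q, (w q / m q) * ∑ i, Real.cos (2 * π * ∑ d, s q i d * τ d)) :
    (∀ s, Z s = ∑ j, phiSM w m s x₁ j * phiSM w m s x₂ j) ∧
      ProbabilityTheory.variance Z
          (Measure.pi fun q => Measure.pi fun _ : Fin (m q) =>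
            Measure.pi fun d => gaussianReal (μ q d) ⟨σ q d ^ 2, sq_nonneg _⟩) =
        ∑ q, (w q ^ 2 / m q) *
          ((1 + kGauss (μ q) (σ q) (2 • τ)) / 2 - kGauss (μ q) (σ q) τ ^ 2) := by
  change _ ∧ variance Z (Measure.pi fun q => Measure.pi fun _ : Fin (m q) =>
            Measure.pi fun d => gaussianReal (μ q d) (sqN (σ q d))) = _
  have hb (q : Fin Q) (p) : MemLp (fun s : Fin D → ℝ => Real.cos (2 * π * ∑ d, s d * τ d)) p
      (Measure.pi fun d => gaussianReal (μ q d) (sqN (σ q d))) :=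
    MemLp.of_bound (Continuous.aestronglyMeasurable (by fun_prop)) 1 (ae_of_all _ fun s => Real.abs_cos_le_one _)
  constructor
  · intro s
    rw [hZ, Fintype.sum_prod_type, Fintype.sum_sigma]
    refine Finset.sum_congr rfl fun q _ => ?_
    rw [Finset.mul_sum]
    refine Finset.sum_congr rfl fun i _ => ?_
    have e : 2 * π * ∑ d, s q i d * τ d
        = 2 * π * ∑ d, s q i d * x₁ d - 2 * π * ∑ d, s q i d * x₂ d := by
      rw [← mul_sub, ← Finset.sum_sub_distrib, hτ]
      simp only [Pi.sub_apply, mul_sub]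
    have h1 : Real.sqrt (w q) * Real.sqrt (w q) = w q := Real.mul_self_sqrt (hw q)
    have h2 : (Real.sqrt (m q))⁻¹ * (Real.sqrt (m q))⁻¹ = (m q : ℝ)⁻¹ := by
      rw [← mul_inv, Real.mul_self_sqrt (Nat.cast_nonneg _)]
    simp only [Fintype.sum_bool, phiSM, e, Real.cos_sub, if_true, Bool.false_eq_true, if_false]
    rw [div_eq_mul_inv, ← h2]
    nth_rw 1 [← h1]
    ring
  · rw [funext hZ]
    have hq (q : Fin Q) : MemLp (fun s : Fin (m q) → Fin D → ℝ =>
        (w q / m q) * ∑ i, Real.cos (2 * π * ∑ d, s i d * τ d)) 2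
        (Measure.pi fun _ : Fin (m q) =>
          Measure.pi fun d => gaussianReal (μ q d) (sqN (σ q d))) := by
      have hs := memLp_finsetSum (p := 2) (μ := Measure.pi fun _ : Fin (m q) =>
          Measure.pi fun d => gaussianReal (μ q d) (sqN (σ q d))) Finset.univ
        (f := fun (i : Fin (m q)) (s : Fin (m q) → Fin D → ℝ) =>
          Real.cos (2 * π * ∑ d, s i d * τ d))
        (fun i _ => MemLp.of_bound (Continuous.aestronglyMeasurable (by fun_prop)) 1
          (ae_of_all _ fun s => Real.abs_cos_le_one _))
      exact hs.const_mul (w q / m q)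
    have h := variance_sum_pi hq
    have e : (fun s : (q : Fin Q) → Fin (m q) → Fin D → ℝ =>
        ∑ q, (w q / m q) * ∑ i, Real.cos (2 * π * ∑ d, s q i d * τ d)) =
        ∑ q, fun s => (w q / m q) * ∑ i, Real.cos (2 * π * ∑ d, s q i d * τ d) := by
      ext s; simp
    rw [e]
    refine h.trans (Finset.sum_congr rfl fun q _ => ?_)
    rw [variance_const_mul]
    have h' := variance_sum_pi (fun _ : Fin (m q) => hb q 2)
    have e' : (fun s : Fin (m q) → Fin D → ℝ =>
        ∑ i, Real.cos (2 * π * ∑ d, s i d * τ d)) =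
        ∑ i, fun s => Real.cos (2 * π * ∑ d, s i d * τ d) := by
      ext s; simp
    rw [e', h', Finset.sum_const, aux_var]
    have : (m q : ℝ) ≠ 0 := by exact_mod_cast (hm q).ne'
    simp only [Finset.card_univ, Fintype.card_fin, nsmul_eq_mul]
    field_simp
end
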